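/- arXiv:2003.12601 — 10 statements merged into one kernel-verified Lean document; each statement's English description precedes it below -/
import Mathlib

section
/- Suppose the data (V,g,ε,ξ,η,φ,h,R) satisfies the (κ,μ)-nullity condition and, with ℓX := R(X,ξ)ξ, the identity φ∘ℓ∘φ − ℓ = 2(φ² + h²) holds (this identity is valid on every contact pseudo-metric manifold). Then h² = (εκ−1)·φ². (Lemma 3.1, equation (3.2).) -/
theorem stmt_1
    {V : Type*} [AddCommGroup V] [Module ℝ V] [FiniteDimensional ℝ V]
    (n : ℕ) (hn : 1 ≤ n)
    (hdim : Module.finrank ℝ V = 2 * n + 1)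
    (g : LinearMap.BilinForm ℝ V)
    (hg_symm : ∀ X Y : V, g X Y = g Y X)
    (hg_nd : g.Nondegenerate)
    (ε : ℝ) (hε : ε = 1 ∨ ε = -1)
    (ξ : V) (hξ : g ξ ξ = ε)
    (η : V → ℝ) (hη : ∀ X : V, η X = ε * g ξ X)
    (φ : V →ₗ[ℝ] V)
    (hφ_sq : ∀ X : V, φ (φ X) = -X + η X • ξ)
    (hφ_g : ∀ X Y : V, g (φ X) (φ Y) = g X Y - ε * η X * η Y)
    (h : V →ₗ[ℝ] V)
    (hh_sym : ∀ X Y : V, g (h X) Y = g X (h Y))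
    (hh_ξ : h ξ = 0)
    (hhφ : ∀ X : V, h (φ X) = - φ (h X))
    (R : V →ₗ[ℝ] V →ₗ[ℝ] V →ₗ[ℝ] V)
    (hR_skew1 : ∀ X Y Z W : V, g (R X Y Z) W = - g (R Y X Z) W)
    (hR_skew2 : ∀ X Y Z W : V, g (R X Y Z) W = - g (R X Y W) Z)
    (hR_pair : ∀ X Y Z W : V, g (R X Y Z) W = g (R Z W X) Y)
    (hR_bianchi : ∀ X Y Z : V, R X Y Z + R Y Z X + R Z X Y = 0)
    (κ μ : ℝ)
    (hnull : ∀ X Y : V, R X Y ξ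
      = (ε * κ) • (η Y • X - η X • Y) + (ε * μ) • (η Y • h X - η X • h Y))
    (hℓident : ∀ X : V, φ (R (φ X) ξ ξ) - R X ξ ξ = (2 : ℝ) • (φ (φ X) + h (h X))) :
    ∀ X : V, h (h X) = (ε * κ - 1) • φ (φ X) := by
  have hε2 : ε * ε = 1 := by rcases hε with rfl | rfl <;> norm_num
  have hηξ : η ξ = 1 := by rw [hη, hξ, hε2]
  have hφφξ : φ (φ ξ) = 0 := by rw [hφ_sq, hηξ, one_smul, neg_add_cancel]
  have hφξ : φ ξ = 0 := by
    have hφξ_eq : φ ξ = η (φ ξ) • ξ := by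
      have hcube := hφ_sq (φ ξ)
      rw [hφφξ, map_zero] at hcube
      exact neg_add_eq_zero.mp hcube.symm
    have hsmul : η (φ ξ) • φ ξ = 0 := by
      rw [← map_smul, ← hφξ_eq, hφφξ]
    rcases smul_eq_zero.mp hsmul with hzero | hzero
    · rw [hφξ_eq, hzero, zero_smul]
    · exact hzero
  have hηh : ∀ X : V, η (h X) = 0 := fun X => by
    rw [hη, ← hh_sym, hh_ξ, map_zero, LinearMap.zero_apply, mul_zero]
  have hℓ : ∀ X : V, R X ξ ξ = (ε * κ) • (X - η X • ξ) + (ε * μ) • h X := fun X => by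
    rw [hnull, hηξ, hh_ξ, one_smul, one_smul, smul_zero, sub_zero]
  intro X
  have hφhφ : φ (h (φ X)) = h X := by
    rw [hhφ, map_neg, hφ_sq, hηh, zero_smul, add_zero, neg_neg]
  have key := hℓident X
  rw [hℓ, hℓ, map_add, map_smul, map_smul, map_sub, map_smul, hφξ, hφhφ, hφ_sq] at key
  rw [hφ_sq]
  have htwo : (2 : ℝ) • h (h X) = (2 : ℝ) • ((ε * κ - 1) • (-X + η X • ξ)) := by
    rw [smul_add] at key
    rw [eq_sub_of_add_eq' key.symm]
    module
  exact smul_right_injective V (two_ne_zero : (2 : ℝ) ≠ 0) htwo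
end

section
/- Suppose εκ < 1, set λ = √(1−εκ) (so λ > 0), and suppose h² = (εκ−1)·φ². Let D(λ) = ker(h − λ·id) and D(−λ) = ker(h + λ·id) and D(0) = span{ξ}. Then V is the internal direct sum D(0) ⊕ D(λ) ⊕ D(−λ), the three subspaces are mutually g-orthogonal, φ maps D(λ) bijectively onto D(−λ) and D(−λ) bijectively onto D(λ), and dim D(λ) = dim D(−λ) = n. (Algebraic content of Theorem 3.3.) -/
theorem stmt_4
    {V : Type*} [AddCommGroup V] [Module ℝ V] [FiniteDimensional ℝ V]
    (n : ℕ) (hn : 1 ≤ n)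
    (hdim : Module.finrank ℝ V = 2 * n + 1)
    (g : LinearMap.BilinForm ℝ V)
    (hg_symm : ∀ X Y : V, g X Y = g Y X)
    (hg_nd : g.Nondegenerate)
    (ε : ℝ) (hε : ε = 1 ∨ ε = -1)
    (ξ : V) (hξ : g ξ ξ = ε)
    (η : V → ℝ) (hη : ∀ X : V, η X = ε * g ξ X)
    (φ : V →ₗ[ℝ] V)
    (hφ_sq : ∀ X : V, φ (φ X) = -X + η X • ξ)
    (hφ_g : ∀ X Y : V, g (φ X) (φ Y) = g X Y - ε * η X * η Y)
    (h : V →ₗ[ℝ] V)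
    (hh_sym : ∀ X Y : V, g (h X) Y = g X (h Y))
    (hh_ξ : h ξ = 0)
    (hhφ : ∀ X : V, h (φ X) = - φ (h X))
    (κ : ℝ)
    (hκ : ε * κ < 1)
    (hh2 : ∀ X : V, h (h X) = (ε * κ - 1) • φ (φ X))
    (lam : ℝ) (hlam : lam = Real.sqrt (1 - ε * κ))
    (D0 Dpos Dneg : Submodule ℝ V)
    (hD0 : D0 = Submodule.span ℝ ({ξ} : Set V))
    (hDpos : Dpos = LinearMap.ker (h - lam • (LinearMap.id : V →ₗ[ℝ] V)))
    (hDneg : Dneg = LinearMap.ker (h + lam • (LinearMap.id : V →ₗ[ℝ] V))) :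
    (∀ X ∈ D0, ∀ Y ∈ Dpos, g X Y = 0) ∧
    (∀ X ∈ D0, ∀ Y ∈ Dneg, g X Y = 0) ∧
    (∀ X ∈ Dpos, ∀ Y ∈ Dneg, g X Y = 0) ∧
    (D0 ⊔ Dpos ⊔ Dneg = ⊤) ∧
    (∀ x₀ ∈ D0, ∀ x₁ ∈ Dpos, ∀ x₂ ∈ Dneg, x₀ + x₁ + x₂ = 0 → x₀ = 0 ∧ x₁ = 0 ∧ x₂ = 0) ∧
    (Submodule.map φ Dpos = Dneg) ∧
    (Submodule.map φ Dneg = Dpos) ∧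
    (∀ X ∈ Dpos, φ X = 0 → X = 0) ∧
    (∀ X ∈ Dneg, φ X = 0 → X = 0) ∧
    (Module.finrank ℝ Dpos = n) ∧
    (Module.finrank ℝ Dneg = n) := by
  have hεε : ε * ε = 1 := by rcases hε with rfl | rfl <;> norm_num
  have hξ0 : ξ ≠ 0 := by
    rintro rfl
    rw [map_zero] at hξ
    rw [← hξ] at hεε
    simp at hεε
  have hηξ : η ξ = 1 := by rw [hη, hξ, hεε]
  have hlam_pos : 0 < lam := by
    rw [hlam]
    exact Real.sqrt_pos.2 (by linarith)
  have hlam0 : lam ≠ 0 := hlam_pos.ne'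
  have hlam_sq : lam * lam = 1 - ε * κ := by
    rw [hlam]
    exact Real.mul_self_sqrt (by linarith)
  have hh_sq : ∀ X, h (h X) = (lam * lam) • (X - η X • ξ) := by
    intro X
    rw [hh2, hφ_sq, hlam_sq]
    module
  have mem_pos : ∀ X, X ∈ Dpos ↔ h X = lam • X := by
    intro X
    simp [hDpos, sub_eq_zero]
  have mem_neg : ∀ X, X ∈ Dneg ↔ h X = -lam • X := by
    intro X
    simp [hDneg, add_eq_zero_iff_eq_neg]
  have ortho_ξ : ∀ s : ℝ, s ≠ 0 → ∀ X, h X = s • X → g ξ X = 0 := by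
    intro s hs X hX
    have := hh_sym ξ X
    rw [hh_ξ, hX] at this
    simpa [hs] using this.symm
  have φ_sq_neg : ∀ s : ℝ, s ≠ 0 → ∀ X, h X = s • X → φ (φ X) = -X := by
    intro s hs X hX
    rw [hφ_sq, hη, ortho_ξ s hs X hX]
    simp
  have ortho_D0 : ∀ s : ℝ, s ≠ 0 → ∀ X ∈ D0, ∀ Y, h Y = s • Y → g X Y = 0 := by
    intro s hs X hX Y hY
    rw [hD0, Submodule.mem_span_singleton] at hX
    obtain ⟨a, rfl⟩ := hX
    simp [ortho_ξ s hs Y hY]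
  have φ_swap : ∀ s : ℝ, ∀ X, h X = s • X → h (φ X) = -s • φ X := by
    intro s X hX
    rw [hhφ, hX, map_smul, neg_smul]
  have map_pos : Submodule.map φ Dpos = Dneg := by
    ext Y
    rw [Submodule.mem_map]
    constructor
    · rintro ⟨X, hX, rfl⟩
      exact (mem_neg _).2 (φ_swap lam X ((mem_pos X).1 hX))
    · intro hY
      rw [mem_neg] at hY
      refine ⟨-φ Y, Dpos.neg_mem ((mem_pos _).2 ?_), ?_⟩
      · simpa using φ_swap (-lam) Y hY
      · rw [map_neg, φ_sq_neg (-lam) (neg_ne_zero.2 hlam0) Y hY, neg_neg]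
  have map_neg' : Submodule.map φ Dneg = Dpos := by
    ext Y
    rw [Submodule.mem_map]
    constructor
    · rintro ⟨X, hX, rfl⟩
      rw [mem_pos]
      simpa using φ_swap (-lam) X ((mem_neg X).1 hX)
    · intro hY
      rw [mem_pos] at hY
      refine ⟨-φ Y, Dneg.neg_mem ((mem_neg _).2 (φ_swap lam Y hY)), ?_⟩
      rw [map_neg, φ_sq_neg lam hlam0 Y hY, neg_neg]
  have φ_inj : ∀ s : ℝ, s ≠ 0 → ∀ X, h X = s • X → φ X = 0 → X = 0 := by
    intro s hs X hX hφX
    have := φ_sq_neg s hs X hX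
    rw [hφX, map_zero] at this
    exact neg_eq_zero.1 this.symm
  have sup_top : D0 ⊔ Dpos ⊔ Dneg = ⊤ := by
    rw [eq_top_iff]
    intro X _
    have hX : X = η X • ξ + (1 / 2 : ℝ) • (X - η X • ξ + lam⁻¹ • h X)
        + (1 / 2 : ℝ) • (X - η X • ξ - lam⁻¹ • h X) := by module
    rw [hX]
    refine Submodule.add_mem_sup (Submodule.add_mem_sup ?_ ?_) ?_
    · rw [hD0]
      exact Submodule.smul_mem _ _ (Submodule.mem_span_singleton_self ξ)
    · rw [mem_pos]
      simp only [map_smul, map_add, map_sub, hh_ξ, hh_sq]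
      match_scalars <;> field_simp
    · rw [mem_neg]
      simp only [map_smul, map_sub, hh_ξ, hh_sq]
      match_scalars <;> field_simp
  have indep : ∀ x₀ ∈ D0, ∀ x₁ ∈ Dpos, ∀ x₂ ∈ Dneg, x₀ + x₁ + x₂ = 0 →
      x₀ = 0 ∧ x₁ = 0 ∧ x₂ = 0 := by
    intro x₀ h₀ x₁ h₁ x₂ h₂ hsum
    rw [mem_pos] at h₁
    rw [mem_neg] at h₂
    have hx₀ : h x₀ = 0 := by
      rw [hD0, Submodule.mem_span_singleton] at h₀
      obtain ⟨a, rfl⟩ := h₀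
      rw [map_smul, hh_ξ, smul_zero]
    have hdiff : lam • (x₁ - x₂) = 0 := by
      have := congrArg h hsum
      rw [map_add, map_add, hx₀, h₁, h₂, map_zero] at this
      rw [← this]
      module
    have heq : x₁ = x₂ := sub_eq_zero.1 ((smul_eq_zero.1 hdiff).resolve_left hlam0)
    subst heq
    have hx₁ : (2 * lam) • x₁ = 0 := by
      have := h₁.symm.trans h₂
      rw [← sub_eq_zero] at this
      rw [← this]
      module
    have hz : x₁ = 0 := (smul_eq_zero.1 hx₁).resolve_left (by positivity)
    subst hz
    exact ⟨by simpa using hsum, rfl, rfl⟩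
  have finrank_eq : Module.finrank ℝ Dpos = Module.finrank ℝ Dneg := by
    apply le_antisymm
    · rw [← map_neg']
      exact Submodule.finrank_map_le φ Dneg
    · rw [← map_pos]
      exact Submodule.finrank_map_le φ Dpos
  have inf₁ : D0 ⊓ Dpos = ⊥ := by
    rw [Submodule.eq_bot_iff]
    rintro X ⟨hX₀, hX₁⟩
    exact (indep X hX₀ (-X) (Dpos.neg_mem hX₁) 0 Dneg.zero_mem (by simp)).1
  have inf₂ : (D0 ⊔ Dpos) ⊓ Dneg = ⊥ := by
    rw [Submodule.eq_bot_iff]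
    rintro X ⟨hX, hX₂⟩
    obtain ⟨x₀, h₀, x₁, h₁, rfl⟩ := Submodule.mem_sup.1 hX
    exact neg_eq_zero.1
      (indep x₀ h₀ x₁ h₁ (-(x₀ + x₁)) (Dneg.neg_mem hX₂) (by simp)).2.2
  have dim₁ := Submodule.finrank_sup_add_finrank_inf_eq D0 Dpos
  have dim₂ := Submodule.finrank_sup_add_finrank_inf_eq (D0 ⊔ Dpos) Dneg
  have dim₀ : Module.finrank ℝ D0 = 1 := by
    rw [hD0]
    exact finrank_span_singleton hξ0
  rw [inf₁, finrank_bot] at dim₁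
  rw [inf₂, finrank_bot, sup_top, finrank_top, hdim] at dim₂
  refine ⟨fun X hX Y hY => ortho_D0 lam hlam0 X hX Y ((mem_pos Y).1 hY),
    fun X hX Y hY => ortho_D0 (-lam) (neg_ne_zero.2 hlam0) X hX Y ((mem_neg Y).1 hY),
    ?_, sup_top, indep, map_pos, map_neg',
    fun X hX => φ_inj lam hlam0 X ((mem_pos X).1 hX),
    fun X hX => φ_inj (-lam) (neg_ne_zero.2 hlam0) X ((mem_neg X).1 hX),
    by omega, by omega⟩
  intro X hX Y hY
  have hXY := hh_sym X Y
  rw [(mem_pos X).1 hX, (mem_neg Y).1 hY] at hXY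
  simp only [map_smul, LinearMap.smul_apply, smul_eq_mul] at hXY
  have : lam * g X Y = 0 := by linarith
  exact (mul_eq_zero.1 this).resolve_left hlam0
end

section
/- Suppose the data (V,g,ε,ξ,η,φ,h,R) satisfies the (κ,μ)-nullity condition, Identity (hR), εκ < 1 and h² = (εκ−1)φ², with λ = √(1−εκ) and D(±λ) the (±λ)-eigenspaces of h. Then for all X_λ, Y_λ ∈ D(λ) and Z_{−λ} ∈ D(−λ): R(X_λ,Y_λ)Z_{−λ} = (κ−εμ)[g(φY_λ,Z_{−λ})φX_λ − g(φX_λ,Z_{−λ})φY_λ]; and for all X_{−λ}, Y_{−λ} ∈ D(−λ) and Z_λ ∈ D(λ): R(X_{−λ},Y_{−λ})Z_λ = (κ−εμ)[g(φY_{−λ},Z_λ)φX_{−λ} − g(φX_{−λ},Z_λ)φY_{−λ}]. (Theorem 3.7, equations (3.9)–(3.10).) -/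
namespace ContactPseudoMetric

variable {V : Type*} [AddCommGroup V] [Module ℝ V] {g : LinearMap.BilinForm ℝ V} {h : V →ₗ[ℝ] V}

/-- Eigenvectors of a self-adjoint map for distinct eigenvalues are orthogonal. -/
lemma eigenvectors_orthogonal (hh_sym : ∀ X Y : V, g (h X) Y = g X (h Y))
    {a b : ℝ} (hab : a ≠ b) {X Y : V} (hX : h X = a • X) (hY : h Y = b • Y) : g X Y = 0 := by
  have key := hh_sym X Y
  simp only [hX, hY, map_smul, LinearMap.smul_apply, smul_eq_mul] at key
  have : (a - b) * g X Y = 0 := by linarith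
  exact (mul_eq_zero.mp this).resolve_left (sub_ne_zero.mpr hab)

/-- If `h² = l² (1 - η ⊗ ξ)`, an element of the `(-l)`-eigenspace of `h` that is orthogonal to that
eigenspace is zero. -/
lemma eq_zero_of_orthogonal_eigenspace
    (hg_nd : g.Nondegenerate) (hh_sym : ∀ X Y : V, g (h X) Y = g X (h Y))
    {ξ : V} (hh_ξ : h ξ = 0) {η : V → ℝ} {l : ℝ} (hl : l ≠ 0)
    (hh2 : ∀ X : V, h (h X) = l ^ 2 • (X - η X • ξ)) {T : V} (hT : h T = (-l) • T)
    (horth : ∀ W : V, h W = (-l) • W → g T W = 0) : T = 0 := by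
  have hTξ : g T ξ = 0 :=
    eigenvectors_orthogonal hh_sym (neg_ne_zero.mpr hl) hT (by simpa using hh_ξ)
  refine hg_nd.1 T fun W => ?_
  have hW : g T (h W - l • W + (l * η W) • ξ) = 0 := by
    apply horth
    simp only [map_add, map_sub, map_smul, hh2, hh_ξ]
    module
  have hsym := hh_sym T W
  simp only [hT, map_add, map_sub, map_smul, LinearMap.smul_apply, smul_eq_mul, hTξ] at hW hsym
  have : l * g T W = 0 := by linarith
  exact (mul_eq_zero.mp this).resolve_left hl

/-- The curvature formula on a pair of eigenspaces `D(l)`, `D(-l)` of `h`, for either sign of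
`l`. -/
lemma curvature_eigenspaces
    (hg_symm : ∀ X Y : V, g X Y = g Y X) (hg_nd : g.Nondegenerate)
    {ε : ℝ} {ξ : V} {η : V → ℝ} (hη : ∀ X : V, η X = ε * g ξ X) {φ : V →ₗ[ℝ] V}
    (hφ_sq : ∀ X : V, φ (φ X) = -X + η X • ξ)
    (hφ_g : ∀ X Y : V, g (φ X) (φ Y) = g X Y - ε * η X * η Y)
    (hh_sym : ∀ X Y : V, g (h X) Y = g X (h Y)) (hh_ξ : h ξ = 0)
    (hhφ : ∀ X : V, h (φ X) = - φ (h X))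
    {R : V →ₗ[ℝ] V →ₗ[ℝ] V →ₗ[ℝ] V}
    (hR_skew1 : ∀ X Y Z W : V, g (R X Y Z) W = - g (R Y X Z) W)
    (hR_bianchi : ∀ X Y Z : V, R X Y Z + R Y Z X + R Z X Y = 0)
    {κ μ : ℝ}
    (hhR : ∀ X Y Z : V, η X = 0 → η Y = 0 → η Z = 0 → R X Y (h Z) - h (R X Y Z)
      = κ • (g Y (φ Z) • φ (h X) - g X (φ Z) • φ (h Y) + g Z (φ (h Y)) • φ X
         - g Z (φ (h X)) • φ Y) - (2 * μ * ε * g X (φ Y)) • φ (h Z))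
    {l : ℝ} (hl : l ≠ 0) (hh2 : ∀ X : V, h (h X) = l ^ 2 • (X - η X • ξ))
    {X Y Z : V} (hX : h X = l • X) (hY : h Y = l • Y) (hZ : h Z = (-l) • Z) :
    R X Y Z = (κ - ε * μ) • (g (φ Y) Z • φ X - g (φ X) Z • φ Y) := by
  have hl' : -l ≠ 0 := neg_ne_zero.mpr hl
  have hne : l ≠ -l := fun e => hl (by linarith)
  have hη0 {a : ℝ} (ha : a ≠ 0) {U : V} (hU : h U = a • U) : η U = 0 := by
    rw [hη, eigenvectors_orthogonal hh_sym ha.symm (by simpa using hh_ξ) hU, mul_zero]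
  have hφp {U : V} (hU : h U = l • U) : h (φ U) = (-l) • φ U := by
    rw [hhφ, hU, map_smul, neg_smul]
  have hφn {U : V} (hU : h U = (-l) • U) : h (φ U) = l • φ U := by
    rw [hhφ, hU, map_smul, neg_smul, neg_neg]
  have hskew {A B : V} (hA : h A = l • A) (hB : h B = (-l) • B) : g A (φ B) = -g (φ A) B := by
    have e := hφ_g A (φ B)
    rw [hφ_sq, hη0 hl' hB, hη0 hl hA, zero_smul, add_zero, map_neg] at e
    linarith
  have hpp {A B : V} (hA : h A = l • A) (hB : h B = l • B) : g A (φ B) = 0 :=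
    eigenvectors_orthogonal hh_sym hne hA (hφp hB)
  have mixed {A C B W : V} (hA : h A = l • A) (hC : h C = (-l) • C) (hB : h B = l • B)
      (hW : h W = (-l) • W) : g (R A C B) W
        = κ * g (φ B) C * g (φ A) W + ε * μ * g (φ A) C * g (φ B) W := by
    have e := congrArg (fun v => g v W) (hhR A C B (hη0 hl hA) (hη0 hl' hC) (hη0 hl hB))
    simp only [hA, hB, hC, map_sub, map_add, map_smul, LinearMap.sub_apply, LinearMap.add_apply,
      LinearMap.smul_apply, smul_eq_mul, hh_sym, hW, hskew hA hC, hskew hB hC, hpp hA hB,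
      hpp hB hA, hg_symm C (φ B)] at e
    apply mul_left_cancel₀ (mul_ne_zero two_ne_zero hl)
    linear_combination e
  have hRZ : h (R X Y Z) = (-l) • R X Y Z := by
    have e := hhR X Y Z (hη0 hl hX) (hη0 hl hY) (hη0 hl' hZ)
    simp only [hX, hY, hZ, map_smul, smul_eq_mul, hskew hX hZ, hskew hY hZ, hpp hX hY,
      hg_symm Z (φ _)] at e
    rw [← sub_eq_zero, ← neg_eq_zero, neg_sub, e]
    module
  rw [← sub_eq_zero]
  refine eq_zero_of_orthogonal_eigenspace hg_nd hh_sym hh_ξ hl hh2 ?_ fun W hW => ?_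
  · simp only [map_sub, map_smul, hRZ, hφp hX, hφp hY]
    module
  · have b := congrArg (fun v => g v W) (hR_bianchi X Y Z)
    have s := hR_skew1 Z X Y W
    simp only [map_add, LinearMap.add_apply, map_zero, LinearMap.zero_apply,
      mixed hY hZ hX hW] at b
    rw [mixed hX hZ hY hW] at s
    simp only [map_sub, map_smul, LinearMap.sub_apply, LinearMap.smul_apply, smul_eq_mul]
    linear_combination b - s

end ContactPseudoMetric


theorem stmt_5
    {V : Type*} [AddCommGroup V] [Module ℝ V] [FiniteDimensional ℝ V]
    (n : ℕ) (hn : 1 ≤ n)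
    (hdim : Module.finrank ℝ V = 2 * n + 1)
    (g : LinearMap.BilinForm ℝ V)
    (hg_symm : ∀ X Y : V, g X Y = g Y X)
    (hg_nd : g.Nondegenerate)
    (ε : ℝ) (hε : ε = 1 ∨ ε = -1)
    (ξ : V) (hξ : g ξ ξ = ε)
    (η : V → ℝ) (hη : ∀ X : V, η X = ε * g ξ X)
    (φ : V →ₗ[ℝ] V)
    (hφ_sq : ∀ X : V, φ (φ X) = -X + η X • ξ)
    (hφ_g : ∀ X Y : V, g (φ X) (φ Y) = g X Y - ε * η X * η Y)
    (h : V →ₗ[ℝ] V)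
    (hh_sym : ∀ X Y : V, g (h X) Y = g X (h Y))
    (hh_ξ : h ξ = 0)
    (hhφ : ∀ X : V, h (φ X) = - φ (h X))
    (R : V →ₗ[ℝ] V →ₗ[ℝ] V →ₗ[ℝ] V)
    (hR_skew1 : ∀ X Y Z W : V, g (R X Y Z) W = - g (R Y X Z) W)
    (hR_skew2 : ∀ X Y Z W : V, g (R X Y Z) W = - g (R X Y W) Z)
    (hR_pair : ∀ X Y Z W : V, g (R X Y Z) W = g (R Z W X) Y)
    (hR_bianchi : ∀ X Y Z : V, R X Y Z + R Y Z X + R Z X Y = 0)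
    (κ μ : ℝ)
    (hnull : ∀ X Y : V, R X Y ξ
      = (ε * κ) • (η Y • X - η X • Y) + (ε * μ) • (η Y • h X - η X • h Y))
    (hhR : ∀ X Y Z : V, R X Y (h Z) - h (R X Y Z)
      = (κ * (η X * g (h Y) Z - η Y * g (h X) Z)
         + μ * (ε * κ - 1) * (η Y * g X Z - η X * g Y Z)) • ξ
      + κ • (g Y (φ Z) • φ (h X) - g X (φ Z) • φ (h Y) + g Z (φ (h Y)) • φ X
         - g Z (φ (h X)) • φ Y + (ε * η Z) • (η X • h Y - η Y • h X))
      - μ • (η Y • (((ε - κ) * η Z) • X + (μ * η X) • h Z)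
         - η X • (((ε - κ) * η Z) • Y + (μ * η Y) • h Z)
         + (2 * ε * g X (φ Y)) • φ (h Z)))
    (hκ : ε * κ < 1)
    (hh2 : ∀ X : V, h (h X) = (ε * κ - 1) • φ (φ X))
    (lam : ℝ) (hlam : lam = Real.sqrt (1 - ε * κ)) :
    (∀ Xp Yp Zn : V, h Xp = lam • Xp → h Yp = lam • Yp → h Zn = (-lam) • Zn →
      R Xp Yp Zn = (κ - ε * μ) • (g (φ Yp) Zn • φ Xp - g (φ Xp) Zn • φ Yp)) ∧
    (∀ Xn Yn Zp : V, h Xn = (-lam) • Xn → h Yn = (-lam) • Yn → h Zp = lam • Zp →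
      R Xn Yn Zp = (κ - ε * μ) • (g (φ Yn) Zp • φ Xn - g (φ Xn) Zp • φ Yn)) := by
  have hpos : 0 < 1 - ε * κ := by linarith
  have hlam0 : lam ≠ 0 := hlam ▸ (Real.sqrt_pos.mpr hpos).ne'
  have hlam2 : lam ^ 2 = 1 - ε * κ := by rw [hlam, Real.sq_sqrt hpos.le]
  have hsq : ∀ X : V, h (h X) = lam ^ 2 • (X - η X • ξ) := fun X => by
    rw [hh2, hφ_sq, hlam2]
    module
  have hhR' : ∀ X Y Z : V, η X = 0 → η Y = 0 → η Z = 0 → R X Y (h Z) - h (R X Y Z)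
      = κ • (g Y (φ Z) • φ (h X) - g X (φ Z) • φ (h Y) + g Z (φ (h Y)) • φ X
         - g Z (φ (h X)) • φ Y) - (2 * μ * ε * g X (φ Y)) • φ (h Z) := by
    intro X Y Z hX hY hZ
    rw [hhR, hX, hY, hZ]
    module
  refine ⟨fun X Y Z hX hY hZ => ?_, fun X Y Z hX hY hZ => ?_⟩
  · exact ContactPseudoMetric.curvature_eigenspaces hg_symm hg_nd hη hφ_sq hφ_g hh_sym hh_ξ hhφ
      hR_skew1 hR_bianchi hhR' hlam0 hsq hX hY hZ
  · exact ContactPseudoMetric.curvature_eigenspaces hg_symm hg_nd hη hφ_sq hφ_g hh_sym hh_ξ hhφ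
      hR_skew1 hR_bianchi hhR' (neg_ne_zero.mpr hlam0) (by simpa only [neg_sq] using hsq)
      hX hY (by rwa [neg_neg])
end

section
/- Suppose the data (V,g,ε,ξ,η,φ,h,R) satisfies the (κ,μ)-nullity condition, Identity (hR), εκ < 1 and h² = (εκ−1)φ², with λ = √(1−εκ) and D(±λ) the (±λ)-eigenspaces of h. Then for all X_{−λ} ∈ D(−λ), Y_λ ∈ D(λ), Z_{−λ} ∈ D(−λ): R(X_{−λ},Y_λ)Z_{−λ} = −κ·g(φY_λ,Z_{−λ})·φX_{−λ} − εμ·g(φY_λ,X_{−λ})·φZ_{−λ}; and for all X_{−λ} ∈ D(−λ), Y_λ, Z_λ ∈ D(λ): R(X_{−λ},Y_λ)Z_λ = κ·g(φX_{−λ},Z_λ)·φY_λ + εμ·g(φX_{−λ},Y_λ)·φZ_λ. (Theorem 3.7, equations (3.11)–(3.12).) -/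
/-- If a self-adjoint `h` satisfies `h² = l² (1 - η ⊗ ξ)` with `l ≠ 0` and `h ξ = 0`, then an
eigenvector for `-l` that is orthogonal to the whole `-l`-eigenspace vanishes. -/
lemma eq_zero_of_orthogonal_eigenspace {V : Type*} [AddCommGroup V] [Module ℝ V]
    {g : LinearMap.BilinForm ℝ V} (hg_nd : g.Nondegenerate) {h : V →ₗ[ℝ] V}
    (hh_sym : ∀ X Y : V, g (h X) Y = g X (h Y)) {ξ : V} (hh_ξ : h ξ = 0) {η : V → ℝ} {l : ℝ}
    (hl : l ≠ 0) (hh2 : ∀ X : V, h (h X) = (l * l) • (X - η X • ξ)) {T : V}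
    (hT : h T = (-l) • T) (hT_orth : ∀ W : V, h W = (-l) • W → g T W = 0) : T = 0 := by
  refine hg_nd.1 T fun W => ?_
  have hTξ : g T ξ = 0 := by
    have := hh_sym T ξ
    simpa [hT, hh_ξ, hl] using this
  have hproj := hT_orth (h W - l • W + (l * η W) • ξ) <| by
    simp only [map_add, map_sub, map_smul, hh2, hh_ξ]
    module
  have hhW := hh_sym T W
  simp only [hT, map_smul, LinearMap.smul_apply, smul_eq_mul] at hhW
  simp only [map_add, map_sub, map_smul, smul_eq_mul, hTξ, ← hhW] at hproj
  have : l * g T W = 0 := by linarith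
  simpa [hl] using this

/-- Eigenvectors of a self-adjoint map for opposite nonzero eigenvalues are orthogonal. -/
lemma eigenvectors_orthogonal {V : Type*} [AddCommGroup V] [Module ℝ V]
    {g : LinearMap.BilinForm ℝ V} {h : V →ₗ[ℝ] V}
    (hh_sym : ∀ X Y : V, g (h X) Y = g X (h Y)) {l : ℝ} (hl : l ≠ 0) {X Y : V}
    (hX : h X = (-l) • X) (hY : h Y = l • Y) : g X Y = 0 := by
  have := hh_sym X Y
  simp only [hX, hY, map_smul, LinearMap.smul_apply, smul_eq_mul] at this
  have : l * g X Y = 0 := by linarith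
  simpa [hl] using this


theorem stmt_6
    {V : Type*} [AddCommGroup V] [Module ℝ V] [FiniteDimensional ℝ V]
    (n : ℕ) (hn : 1 ≤ n)
    (hdim : Module.finrank ℝ V = 2 * n + 1)
    (g : LinearMap.BilinForm ℝ V)
    (hg_symm : ∀ X Y : V, g X Y = g Y X)
    (hg_nd : g.Nondegenerate)
    (ε : ℝ) (hε : ε = 1 ∨ ε = -1)
    (ξ : V) (hξ : g ξ ξ = ε)
    (η : V → ℝ) (hη : ∀ X : V, η X = ε * g ξ X)
    (φ : V →ₗ[ℝ] V)
    (hφ_sq : ∀ X : V, φ (φ X) = -X + η X • ξ)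
    (hφ_g : ∀ X Y : V, g (φ X) (φ Y) = g X Y - ε * η X * η Y)
    (h : V →ₗ[ℝ] V)
    (hh_sym : ∀ X Y : V, g (h X) Y = g X (h Y))
    (hh_ξ : h ξ = 0)
    (hhφ : ∀ X : V, h (φ X) = - φ (h X))
    (R : V →ₗ[ℝ] V →ₗ[ℝ] V →ₗ[ℝ] V)
    (hR_skew1 : ∀ X Y Z W : V, g (R X Y Z) W = - g (R Y X Z) W)
    (hR_skew2 : ∀ X Y Z W : V, g (R X Y Z) W = - g (R X Y W) Z)
    (hR_pair : ∀ X Y Z W : V, g (R X Y Z) W = g (R Z W X) Y)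
    (hR_bianchi : ∀ X Y Z : V, R X Y Z + R Y Z X + R Z X Y = 0)
    (κ μ : ℝ)
    (hnull : ∀ X Y : V, R X Y ξ
      = (ε * κ) • (η Y • X - η X • Y) + (ε * μ) • (η Y • h X - η X • h Y))
    (hhR : ∀ X Y Z : V, R X Y (h Z) - h (R X Y Z)
      = (κ * (η X * g (h Y) Z - η Y * g (h X) Z)
         + μ * (ε * κ - 1) * (η Y * g X Z - η X * g Y Z)) • ξ
      + κ • (g Y (φ Z) • φ (h X) - g X (φ Z) • φ (h Y) + g Z (φ (h Y)) • φ X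
         - g Z (φ (h X)) • φ Y + (ε * η Z) • (η X • h Y - η Y • h X))
      - μ • (η Y • (((ε - κ) * η Z) • X + (μ * η X) • h Z)
         - η X • (((ε - κ) * η Z) • Y + (μ * η Y) • h Z)
         + (2 * ε * g X (φ Y)) • φ (h Z)))
    (hκ : ε * κ < 1)
    (hh2 : ∀ X : V, h (h X) = (ε * κ - 1) • φ (φ X))
    (lam : ℝ) (hlam : lam = Real.sqrt (1 - ε * κ)) :
    (∀ Xn Yp Zn : V, h Xn = (-lam) • Xn → h Yp = lam • Yp → h Zn = (-lam) • Zn →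
      R Xn Yp Zn = (-(κ * g (φ Yp) Zn)) • φ Xn - (ε * μ * g (φ Yp) Xn) • φ Zn) ∧
    (∀ Xn Yp Zp : V, h Xn = (-lam) • Xn → h Yp = lam • Yp → h Zp = lam • Zp →
      R Xn Yp Zp = (κ * g (φ Xn) Zp) • φ Yp + (ε * μ * g (φ Xn) Yp) • φ Zp) := by
  have hε2 : ε * ε = 1 := by rcases hε with rfl | rfl <;> norm_num
  have hηφ (X : V) : η (φ X) = 0 := by
    have e := hφ_g (φ X) ξ
    have hφξ : φ ξ = 0 := by
      have hηξ : η ξ = 1 := by rw [hη, hξ, hε2]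
      have h2 : φ (φ ξ) = 0 := by rw [hφ_sq, hηξ]; module
      have h3 : φ ξ = η (φ ξ) • ξ := by
        have := hφ_sq (φ ξ)
        rw [h2, map_zero] at this
        rwa [eq_comm, neg_add_eq_zero] at this
      have h4 : η (φ ξ) • φ ξ = 0 := by rw [← map_smul, ← h3, h2]
      rcases smul_eq_zero.mp h4 with h5 | h5
      · rw [h3, h5, zero_smul]
      · exact h5
    have hcomm : φ (-X + η X • ξ) = -φ X + η (φ X) • ξ := by rw [← hφ_sq, hφ_sq]
    have hzero : η (φ X) • ξ = 0 := by
      simpa [hφξ] using hcomm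
    rcases smul_eq_zero.mp hzero with h5 | h5
    · exact h5
    · rw [hη, h5]; simp
  have hφ_skew (X Y : V) : g (φ X) Y = -g X (φ Y) := by
    have e := hφ_g X (φ Y)
    have hξφ : ε * g ξ (φ X) = 0 := by rw [← hη, hηφ]
    have hξφ' : g (φ X) ξ = 0 := by
      rw [hg_symm]
      linear_combination ε * hξφ - g ξ (φ X) * hε2
    rw [hφ_sq, hηφ] at e
    simp only [map_add, map_neg, map_smul, smul_eq_mul, hξφ'] at e
    linarith
  have key (l : ℝ) (hl : l ≠ 0) (hl2 : l * l = 1 - ε * κ) (X Y Z : V)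
      (hX : h X = (-l) • X) (hY : h Y = l • Y) (hZ : h Z = (-l) • Z) :
      R X Y Z = (-(κ * g (φ Y) Z)) • φ X - (ε * μ * g (φ Y) X) • φ Z := by
    have hη0 (m : ℝ) (hm : m ≠ 0) (U : V) (hU : h U = m • U) : η U = 0 := by
      have := hh_sym ξ U
      simp only [hh_ξ, hU, map_zero, map_smul, LinearMap.zero_apply, smul_eq_mul] at this
      rw [hη, (mul_eq_zero.mp this.symm).resolve_left hm, mul_zero]
    have hφn (U : V) (hU : h U = (-l) • U) : h (φ U) = l • φ U := by
      rw [hhφ, hU, map_smul]; module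
    have horth (U W : V) (hU : h U = (-l) • U) (hW : h W = (-l) • W) : g U (φ W) = 0 :=
      eigenvectors_orthogonal hh_sym hl hU (hφn W hW)
    have hηn (U : V) (hU : h U = (-l) • U) : η U = 0 := hη0 (-l) (neg_ne_zero.mpr hl) U hU
    rw [← sub_eq_zero]
    refine eq_zero_of_orthogonal_eigenspace (η := η) hg_nd hh_sym hh_ξ hl
      (fun U => ?_) ?_ fun W hW => ?_
    · rw [hh2, hφ_sq, hl2]; module
    · have e := hhR X Y Z
      have hYZ : g Y (φ Z) = -g (φ Y) Z := by rw [hφ_skew, neg_neg]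
      simp only [hηn X hX, hηn Z hZ, hη0 l hl Y hY, hX, hY, hZ, map_smul, smul_eq_mul,
        horth X Z hX hZ, horth Z X hZ hX, hYZ, hg_symm Z (φ Y), hg_symm X (φ Y)] at e
      simp only [map_sub, map_smul, hφn X hX, hφn Z hZ]
      linear_combination (norm := module) -e
    · have hRW : g (R X Y Z) W = 0 := by
        have e := hhR Z W X
        simp only [hηn X hX, hηn Z hZ, hηn W hW, hX, hW, hZ, map_smul, smul_eq_mul,
          horth W X hW hX, horth Z X hZ hX, horth X W hX hW, horth X Z hX hZ,
          horth Z W hZ hW] at e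
        have e' : h (R Z W X) = (-l) • R Z W X := by
          linear_combination (norm := module) -e
        rw [hR_pair]
        exact eigenvectors_orthogonal hh_sym hl e' hY
      have hφW (U : V) (hU : h U = (-l) • U) : g (φ U) W = 0 := by
        rw [hg_symm, horth W U hW hU]
      simp [hRW, hφW X hX, hφW Z hZ]
  have hpos : 0 < 1 - ε * κ := by linarith
  have hlam0 : lam ≠ 0 := by rw [hlam]; exact (Real.sqrt_pos.mpr hpos).ne'
  have hlam2 : lam * lam = 1 - ε * κ := by rw [hlam, Real.mul_self_sqrt hpos.le]
  refine ⟨key lam hlam0 hlam2, fun X Y Z hX hY hZ => ?_⟩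
  have hswap : R X Y Z = -R Y X Z := by
    rw [← add_eq_zero_iff_eq_neg]
    refine hg_nd.1 _ fun W => ?_
    simp [hR_skew1 X Y Z W]
  rw [hswap, key (-lam) (neg_ne_zero.mpr hlam0) (by rw [neg_mul_neg, hlam2]) Y X Z
    (by rwa [neg_neg]) hX (by rwa [neg_neg])]
  module
end

section
/- Suppose the data (V,g,ε,ξ,η,φ,h,R) satisfies the (κ,μ)-nullity condition, Identity (φR), Identity (hR), εκ < 1 and h² = (εκ−1)φ², with λ = √(1−εκ) and D(±λ) the (±λ)-eigenspaces of h. Then for all X, Y, Z ∈ D(λ): R(X,Y)Z = [2(ε+λ) − εμ][g(Y,Z)X − g(X,Z)Y]; and for all X, Y, Z ∈ D(−λ): R(X,Y)Z = [2(ε−λ) − εμ][g(Y,Z)X − g(X,Z)Y]. (Theorem 3.7, equations (3.13)–(3.14).) -/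
theorem stmt_7
    {V : Type*} [AddCommGroup V] [Module ℝ V] [FiniteDimensional ℝ V]
    (n : ℕ) (hn : 1 ≤ n)
    (hdim : Module.finrank ℝ V = 2 * n + 1)
    (g : LinearMap.BilinForm ℝ V)
    (hg_symm : ∀ X Y : V, g X Y = g Y X)
    (hg_nd : g.Nondegenerate)
    (ε : ℝ) (hε : ε = 1 ∨ ε = -1)
    (ξ : V) (hξ : g ξ ξ = ε)
    (η : V → ℝ) (hη : ∀ X : V, η X = ε * g ξ X)
    (φ : V →ₗ[ℝ] V)
    (hφ_sq : ∀ X : V, φ (φ X) = -X + η X • ξ)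
    (hφ_g : ∀ X Y : V, g (φ X) (φ Y) = g X Y - ε * η X * η Y)
    (h : V →ₗ[ℝ] V)
    (hh_sym : ∀ X Y : V, g (h X) Y = g X (h Y))
    (hh_ξ : h ξ = 0)
    (hhφ : ∀ X : V, h (φ X) = - φ (h X))
    (R : V →ₗ[ℝ] V →ₗ[ℝ] V →ₗ[ℝ] V)
    (hR_skew1 : ∀ X Y Z W : V, g (R X Y Z) W = - g (R Y X Z) W)
    (hR_skew2 : ∀ X Y Z W : V, g (R X Y Z) W = - g (R X Y W) Z)
    (hR_pair : ∀ X Y Z W : V, g (R X Y Z) W = g (R Z W X) Y)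
    (hR_bianchi : ∀ X Y Z : V, R X Y Z + R Y Z X + R Z X Y = 0)
    (κ μ : ℝ)
    (hnull : ∀ X Y : V, R X Y ξ
      = (ε * κ) • (η Y • X - η X • Y) + (ε * μ) • (η Y • h X - η X • h Y))
    (hφR : ∀ X Y Z : V, R X Y (φ Z) = φ (R X Y Z)
      + ((1 - ε * κ) * (η X * g (φ Y) Z - η Y * g (φ X) Z)
         + ε * (1 - μ) * (η X * g (φ (h Y)) Z - η Y * g (φ (h X)) Z)) • ξ
      - g (Y + ε • h Y) Z • (ε • φ X + φ (h X))
      + g (X + ε • h X) Z • (ε • φ Y + φ (h Y))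
      - g (ε • φ Y + φ (h Y)) Z • (X + ε • h X)
      + g (ε • φ X + φ (h X)) Z • (Y + ε • h Y)
      - η Z • ((1 - ε * κ) • (η X • φ Y - η Y • φ X)
         + (ε * (1 - μ)) • (η X • φ (h Y) - η Y • φ (h X))))
    (hhR : ∀ X Y Z : V, R X Y (h Z) - h (R X Y Z)
      = (κ * (η X * g (h Y) Z - η Y * g (h X) Z)
         + μ * (ε * κ - 1) * (η Y * g X Z - η X * g Y Z)) • ξ
      + κ • (g Y (φ Z) • φ (h X) - g X (φ Z) • φ (h Y) + g Z (φ (h Y)) • φ X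
         - g Z (φ (h X)) • φ Y + (ε * η Z) • (η X • h Y - η Y • h X))
      - μ • (η Y • (((ε - κ) * η Z) • X + (μ * η X) • h Z)
         - η X • (((ε - κ) * η Z) • Y + (μ * η Y) • h Z)
         + (2 * ε * g X (φ Y)) • φ (h Z)))
    (hκ : ε * κ < 1)
    (hh2 : ∀ X : V, h (h X) = (ε * κ - 1) • φ (φ X))
    (lam : ℝ) (hlam : lam = Real.sqrt (1 - ε * κ)) :
    (∀ X Y Z : V, h X = lam • X → h Y = lam • Y → h Z = lam • Z →
      R X Y Z = (2 * (ε + lam) - ε * μ) • (g Y Z • X - g X Z • Y)) ∧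
    (∀ X Y Z : V, h X = (-lam) • X → h Y = (-lam) • Y → h Z = (-lam) • Z →
      R X Y Z = (2 * (ε - lam) - ε * μ) • (g Y Z • X - g X Z • Y)) := by
  have hεε : ε * ε = 1 := by rcases hε with rfl | rfl <;> norm_num
  have hη_ξ : η ξ = 1 := by rw [hη, hξ, hεε]
  have hξ_ne : ξ ≠ 0 := by
    rintro rfl
    simp [hη] at hη_ξ
  have hφ_ξ : φ ξ = 0 := by
    have hφφ : φ (φ ξ) = 0 := by simp [hφ_sq, hη_ξ]
    have hφ_eq : φ ξ = η (φ ξ) • ξ := by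
      have := hφ_sq (φ ξ)
      rw [hφφ, map_zero] at this
      exact (neg_add_eq_zero.mp this.symm)
    have hmul : (η (φ ξ) * η (φ ξ)) • ξ = 0 := by
      rw [mul_smul, ← hφ_eq, ← map_smul, ← hφ_eq, hφφ]
    have hzero : η (φ ξ) = 0 := by simpa [hξ_ne] using hmul
    rw [hφ_eq, hzero, zero_smul]
  have hη_φ : ∀ X, η (φ X) = 0 := by
    intro X
    have h₁ := hφ_sq (φ X)
    rw [hφ_sq X, map_add, map_neg, map_smul, hφ_ξ, smul_zero, add_zero] at h₁
    have h₂ : η (φ X) • ξ = 0 := by simpa using h₁.symm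
    simpa [hξ_ne] using h₂
  have hg_ξ : ∀ X, g ξ X = ε * η X := by
    intro X
    rw [hη, ← mul_assoc, hεε, one_mul]
  have hφ_skew : ∀ X Y, g (φ X) Y = -g X (φ Y) := by
    intro X Y
    have h₁ := hφ_g X (φ Y)
    rw [hφ_sq Y, map_add, map_neg, map_smul, hg_symm (φ X) ξ, hg_ξ, hη_φ, hη_φ] at h₁
    simp only [mul_zero, smul_zero, add_zero, sub_zero] at h₁
    linarith
  have key : ∀ s : ℝ, s ≠ 0 → s * s = 1 - ε * κ → ∀ X Y Z : V,
      h X = s • X → h Y = s • Y → h Z = s • Z →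
      R X Y Z = (2 * (ε + s) - ε * μ) • (g Y Z • X - g X Z • Y) := by
    intro s hs hss
    have η_eigen : ∀ t : ℝ, t ≠ 0 → ∀ X, h X = t • X → η X = 0 := by
      intro t ht X hX
      have h₁ := hh_sym ξ X
      rw [hh_ξ, hX, map_smul, hg_ξ] at h₁
      have hε0 : ε ≠ 0 := left_ne_zero_of_mul_eq_one hεε
      simpa [ht, hε0] using h₁.symm
    have φ_eigen : ∀ t : ℝ, ∀ X, h X = t • X → h (φ X) = (-t) • φ X := by
      intro t X hX
      rw [hhφ, hX, map_smul, neg_smul]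
    have orth : ∀ X Y, h X = s • X → h Y = (-s) • Y → g X Y = 0 := by
      intro X Y hX hY
      have h₁ := hh_sym X Y
      rw [hX, hY] at h₁
      simp only [map_smul, LinearMap.smul_apply, smul_eq_mul] at h₁
      have h₂ : s * g X Y = 0 := by linarith
      simpa [hs] using h₂
    have mixed : ∀ X Y Z W, h X = s • X → h Y = (-s) • Y → h Z = (-s) • Z → h W = s • W →
        g (R X Y Z) W
          = -κ * (g X (φ Z) * g (φ Y) W) - μ * ε * (g X (φ Y) * g (φ Z) W) := by
      intro X Y Z W hX hY hZ hW
      have hX0 := η_eigen s hs X hX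
      have hY0 := η_eigen (-s) (neg_ne_zero.mpr hs) Y hY
      have hφZ : h (φ Z) = s • φ Z := by simpa using φ_eigen _ Z hZ
      have hφY : h (φ Y) = s • φ Y := by simpa using φ_eigen _ Y hY
      have hYZ : g Y (φ Z) = 0 := by rw [hg_symm]; exact orth _ _ hφZ hY
      have hZY : g Z (φ Y) = 0 := by rw [hg_symm]; exact orth _ _ hφY hZ
      have hZX : g Z (φ X) = -g X (φ Z) := by rw [hg_symm, hφ_skew]
      have h₁ := congrArg (fun U => g U W) (hhR X Y Z)
      simp only [hX, hY, hZ, hX0, hY0, map_smul, map_sub, map_add, LinearMap.sub_apply,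
        LinearMap.add_apply, LinearMap.smul_apply, smul_eq_mul, hh_sym (R X Y Z) W, hW,
        hYZ, hZY, hZX] at h₁
      have h₂ : (2 * s) * g (R X Y Z) W = (2 * s) *
          (-κ * (g X (φ Z) * g (φ Y) W) - μ * ε * (g X (φ Y) * g (φ Z) W)) := by
        simp only [zero_mul, mul_zero, sub_zero, add_zero, zero_add, zero_sub] at h₁
        linear_combination -h₁
      exact mul_left_cancel₀ (mul_ne_zero two_ne_zero hs) h₂
    intro X Y Z hX hY hZ
    have hX0 := η_eigen s hs X hX
    have hY0 := η_eigen s hs Y hY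
    have hZ0 := η_eigen s hs Z hZ
    have hXφ : ∀ A B, h A = s • A → h B = s • B → g A (φ B) = 0 :=
      fun A B hA hB => orth _ _ hA (φ_eigen _ B hB)
    have hR_eigen : h (R X Y Z) = s • R X Y Z := by
      have h₁ := hhR X Y Z
      simp only [hX, hY, hZ, hX0, hY0, map_smul, smul_eq_mul, hXφ _ _ hX hY, hXφ _ _ hY hZ,
        hXφ _ _ hX hZ, hXφ _ _ hZ hX, hXφ _ _ hZ hY] at h₁
      simp only [zero_mul, mul_zero, sub_zero, add_zero, zero_smul, smul_zero] at h₁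
      exact (sub_eq_zero.mp h₁).symm
    have hφφ : ∀ A, h A = s • A → φ (φ A) = -A := by
      intro A hA
      rw [hφ_sq, η_eigen s hs A hA, zero_smul, add_zero]
    have hφφ_g : ∀ A B, h A = s • A → g (φ A) (φ B) = g A B := by
      intro A B hA
      rw [hφ_g, η_eigen s hs A hA]
      ring
    have on_eigen : ∀ W, h W = s • W → g (R X Y Z) W
        = (2 * (ε + s) - ε * μ) * (g Y Z * g X W - g X Z * g Y W) := by
      intro W hW
      have h₁ : g (R X Y (φ Z)) (φ W)
          = (κ - ε * μ) * (g X W * g Y Z - g Y W * g X Z) := by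
        have hb := congrArg (fun U => g U (φ W)) (hR_bianchi X Y (φ Z))
        simp only [map_add, LinearMap.add_apply, map_zero, LinearMap.zero_apply] at hb
        have e₁ := mixed Y (φ Z) (φ W) X hY (φ_eigen _ Z hZ) (φ_eigen _ W hW) hX
        have e₂ := mixed X (φ Z) (φ W) Y hX (φ_eigen _ Z hZ) (φ_eigen _ W hW) hY
        simp only [hφφ _ hZ, hφφ _ hW, map_neg, LinearMap.neg_apply] at e₁ e₂
        rw [hg_symm Z X, hg_symm W X] at e₁
        rw [hg_symm Z Y, hg_symm W Y] at e₂
        have e₃ := hR_skew2 Y (φ Z) X (φ W)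
        have e₄ := hR_skew1 (φ Z) X Y (φ W)
        have e₅ := hR_skew2 X (φ Z) Y (φ W)
        linear_combination hb - e₃ - e₄ + e₅ + e₁ - e₂
      have h₂ := congrArg (fun U => g U (φ W)) (hφR X Y Z)
      simp only [hX, hY, hX0, hY0, hZ0, map_smul, map_sub, map_add, LinearMap.sub_apply,
        LinearMap.add_apply, LinearMap.smul_apply, smul_eq_mul, hφφ_g _ _ hR_eigen,
        hφφ_g _ _ hX, hφφ_g _ _ hY, hXφ _ _ hX hW, hXφ _ _ hY hW, h₁] at h₂
      simp only [zero_mul, mul_zero, sub_zero, add_zero] at h₂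
      linear_combination -h₂ + (g Y Z * g X W - g X Z * g Y W) *
        (ε * hss + (s - κ) * hεε)
    apply eq_of_sub_eq_zero
    apply hg_nd.1
    intro U
    set D := R X Y Z - (2 * (ε + s) - ε * μ) • (g Y Z • X - g X Z • Y) with hD
    have hD_eigen : h D = s • D := by
      simp only [hD, map_sub, map_smul, hR_eigen, hX, hY]
      module
    have hW : h (s • U + h U - (s * η U) • ξ) = s • (s • U + h U - (s * η U) • ξ) := by
      simp only [map_sub, map_add, map_smul, hh_ξ, hh2, hφ_sq]
      have : ε * κ - 1 = -(s * s) := by linarith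
      rw [this]
      module
    have h₁ : g D (s • U + h U - (s * η U) • ξ) = 0 := by
      have h₂ := on_eigen _ hW
      generalize s • U + h U - (s * η U) • ξ = W at h₂ ⊢
      simp only [hD, map_sub, map_smul, LinearMap.sub_apply, LinearMap.smul_apply, smul_eq_mul]
      rw [h₂]
      ring
    have hDξ : g D ξ = 0 := by
      rw [hg_symm, hg_ξ, η_eigen s hs D hD_eigen, mul_zero]
    rw [map_sub, map_add, map_smul, map_smul, ← hh_sym, hD_eigen, hDξ] at h₁
    simp only [map_smul, LinearMap.smul_apply, smul_eq_mul, mul_zero, sub_zero] at h₁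
    have h₂ : s * g D U = 0 := by linarith
    simpa [hs] using h₂
  have hpos : 0 < 1 - ε * κ := by linarith
  have hlam_ne : lam ≠ 0 := by
    rw [hlam]
    exact (Real.sqrt_pos.mpr hpos).ne'
  have hlam_sq : lam * lam = 1 - ε * κ := by
    rw [hlam]
    exact Real.mul_self_sqrt hpos.le
  refine ⟨key lam hlam_ne hlam_sq, ?_⟩
  have := key (-lam) (neg_ne_zero.mpr hlam_ne) (by linarith [neg_mul_neg lam lam])
  simpa only [← sub_eq_add_neg] using this
end

section
/- Suppose the data (V,g,ε,ξ,η,φ,h,R) satisfies the (κ,μ)-nullity condition, Identity (φR), Identity (hR), εκ < 1 and h² = (εκ−1)φ², with λ = √(1−εκ) and D(±λ) the (±λ)-eigenspaces of h. Define the sectional curvature of a nondegenerate plane spanned by X,Y (i.e. g(X,X)g(Y,Y) − g(X,Y)² ≠ 0) by K(X,Y) := g(R(X,Y)Y,X)/(g(X,X)g(Y,Y) − g(X,Y)²). Then: (1) for X,Y ∈ D(λ) spanning a nondegenerate plane, K(X,Y) = 2(ε+λ) − εμ; (2) for X ∈ D(λ), Y ∈ D(−λ) with g(X,X)·g(Y,Y)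 ≠ 0, K(X,Y) = −(κ+εμ)·g(X,φY)²/(g(X,X)g(Y,Y)); (3) for X,Y ∈ D(−λ) spanning a nondegenerate plane, K(X,Y) = 2(ε−λ) − εμ. (Theorem 3.8(ii).) -/
section Eigenvectors

variable {V : Type*} [AddCommGroup V] [Module ℝ V]

/-- Eigenvectors of a self-adjoint map for distinct eigenvalues are orthogonal. -/
theorem bilin_eq_zero_of_eigen {g : LinearMap.BilinForm ℝ V} {h : V →ₗ[ℝ] V}
    (hh_sym : ∀ X Y : V, g (h X) Y = g X (h Y)) {a b : ℝ} (hab : a ≠ b) {X Y : V}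
    (hX : h X = a • X) (hY : h Y = b • Y) : g X Y = 0 := by
  have H := hh_sym X Y
  simp only [hX, hY, map_smul, LinearMap.smul_apply, smul_eq_mul] at H
  have H' : (a - b) * g X Y = 0 := by linear_combination H
  exact (mul_eq_zero.mp H').resolve_left (sub_ne_zero.mpr hab)

/-- The curvature on `D(l) × D(-l) × D(l) × D(-l)`, where the second and fourth arguments are
written as images under `φ` of vectors of `D(l)`. -/
theorem curvature_mixed_eigen
    {g : LinearMap.BilinForm ℝ V} (hg_symm : ∀ X Y : V, g X Y = g Y X)
    {ε : ℝ} {ξ : V} {η : V → ℝ} (hη : ∀ X : V, η X = ε * g ξ X)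
    {φ : V →ₗ[ℝ] V} (hφ_sq : ∀ X : V, φ (φ X) = -X + η X • ξ)
    (hφ_g : ∀ X Y : V, g (φ X) (φ Y) = g X Y - ε * η X * η Y)
    {h : V →ₗ[ℝ] V} (hh_sym : ∀ X Y : V, g (h X) Y = g X (h Y))
    (hh_ξ : h ξ = 0) (hhφ : ∀ X : V, h (φ X) = - φ (h X))
    {R : V →ₗ[ℝ] V →ₗ[ℝ] V →ₗ[ℝ] V} {κ μ : ℝ}
    (hhR : ∀ X Y Z : V, R X Y (h Z) - h (R X Y Z)
      = (κ * (η X * g (h Y) Z - η Y * g (h X) Z)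
         + μ * (ε * κ - 1) * (η Y * g X Z - η X * g Y Z)) • ξ
      + κ • (g Y (φ Z) • φ (h X) - g X (φ Z) • φ (h Y) + g Z (φ (h Y)) • φ X
         - g Z (φ (h X)) • φ Y + (ε * η Z) • (η X • h Y - η Y • h X))
      - μ • (η Y • (((ε - κ) * η Z) • X + (μ * η X) • h Z)
         - η X • (((ε - κ) * η Z) • Y + (μ * η Y) • h Z)
         + (2 * ε * g X (φ Y)) • φ (h Z)))
    {l : ℝ} (hl : l ≠ 0) {X Y Z W : V}
    (hX : h X = l • X) (hY : h Y = l • Y) (hZ : h Z = l • Z) (hW : h W = l • W) :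
    g (R Y (φ Z) X) (φ W) = κ * (g X Z * g Y W) + ε * μ * (g Y Z * g X W) := by
  have hl2 : l ≠ -l := fun e => hl (by linarith)
  have hξ0 : h ξ = (0 : ℝ) • ξ := by rw [hh_ξ, zero_smul]
  have hφe : ∀ {A : V}, h A = l • A → h (φ A) = (-l) • φ A := fun hA => by
    rw [hhφ, hA, map_smul, neg_smul]
  have η0 : ∀ {A : V} {a : ℝ}, a ≠ 0 → h A = a • A → η A = 0 := fun ha hA => by
    rw [hη, bilin_eq_zero_of_eigen hh_sym ha.symm hξ0 hA, mul_zero]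
  have eX := η0 hl hX
  have eY := η0 hl hY
  have eZ := η0 hl hZ
  have eφZ := η0 (neg_ne_zero.mpr hl) (hφe hZ)
  have eφW := η0 (neg_ne_zero.mpr hl) (hφe hW)
  have hξφW : g ξ (φ W) = 0 := bilin_eq_zero_of_eigen hh_sym
    (neg_ne_zero.mpr hl).symm hξ0 (hφe hW)
  have hYφX : g Y (φ X) = 0 := bilin_eq_zero_of_eigen hh_sym hl2 hY (hφe hX)
  have hXφY : g X (φ Y) = 0 := bilin_eq_zero_of_eigen hh_sym hl2 hX (hφe hY)
  have hself := hh_sym (R Y (φ Z) X) (φ W)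
  have H := congrArg (fun v => g v (φ W)) (hhR Y (φ Z) X)
  simp only [hφe hZ, hφe hW, hX, hY, eX, eY, eφZ, hφ_sq, eZ, map_smul, map_add, map_sub, map_neg,
    LinearMap.add_apply, LinearMap.sub_apply, LinearMap.smul_apply, LinearMap.neg_apply,
    smul_eq_mul, hφ_g, hYφX, hXφY, hξφW, zero_smul, map_zero, LinearMap.zero_apply,
    hg_symm Z X] at H hself
  have H2 : 2 * l * (g (R Y (φ Z) X) (φ W)
      - (κ * (g X Z * g Y W) + ε * μ * (g Y Z * g X W))) = 0 := by
    linear_combination H + hself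
  have := (mul_eq_zero.mp H2).resolve_left (mul_ne_zero two_ne_zero hl)
  linarith

/-- The curvature on `D(l)` is that of a space of constant curvature `2 * (ε + l) - ε * μ`. -/
theorem curvature_eigen
    {g : LinearMap.BilinForm ℝ V} (hg_symm : ∀ X Y : V, g X Y = g Y X)
    {ε : ℝ} (hε : ε = 1 ∨ ε = -1) {ξ : V} {η : V → ℝ} (hη : ∀ X : V, η X = ε * g ξ X)
    {φ : V →ₗ[ℝ] V} (hφ_sq : ∀ X : V, φ (φ X) = -X + η X • ξ)
    (hφ_g : ∀ X Y : V, g (φ X) (φ Y) = g X Y - ε * η X * η Y)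
    {h : V →ₗ[ℝ] V} (hh_sym : ∀ X Y : V, g (h X) Y = g X (h Y))
    (hh_ξ : h ξ = 0) (hhφ : ∀ X : V, h (φ X) = - φ (h X))
    {R : V →ₗ[ℝ] V →ₗ[ℝ] V →ₗ[ℝ] V}
    (hR_skew1 : ∀ X Y Z W : V, g (R X Y Z) W = - g (R Y X Z) W)
    (hR_bianchi : ∀ X Y Z : V, R X Y Z + R Y Z X + R Z X Y = 0)
    {κ μ : ℝ}
    (hφR : ∀ X Y Z : V, R X Y (φ Z) = φ (R X Y Z)
      + ((1 - ε * κ) * (η X * g (φ Y) Z - η Y * g (φ X) Z)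
         + ε * (1 - μ) * (η X * g (φ (h Y)) Z - η Y * g (φ (h X)) Z)) • ξ
      - g (Y + ε • h Y) Z • (ε • φ X + φ (h X))
      + g (X + ε • h X) Z • (ε • φ Y + φ (h Y))
      - g (ε • φ Y + φ (h Y)) Z • (X + ε • h X)
      + g (ε • φ X + φ (h X)) Z • (Y + ε • h Y)
      - η Z • ((1 - ε * κ) • (η X • φ Y - η Y • φ X)
         + (ε * (1 - μ)) • (η X • φ (h Y) - η Y • φ (h X))))
    (hhR : ∀ X Y Z : V, R X Y (h Z) - h (R X Y Z)
      = (κ * (η X * g (h Y) Z - η Y * g (h X) Z)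
         + μ * (ε * κ - 1) * (η Y * g X Z - η X * g Y Z)) • ξ
      + κ • (g Y (φ Z) • φ (h X) - g X (φ Z) • φ (h Y) + g Z (φ (h Y)) • φ X
         - g Z (φ (h X)) • φ Y + (ε * η Z) • (η X • h Y - η Y • h X))
      - μ • (η Y • (((ε - κ) * η Z) • X + (μ * η X) • h Z)
         - η X • (((ε - κ) * η Z) • Y + (μ * η Y) • h Z)
         + (2 * ε * g X (φ Y)) • φ (h Z)))
    {l : ℝ} (hl : l ≠ 0) (hlsq : l ^ 2 = 1 - ε * κ) {X Y Z W : V}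
    (hX : h X = l • X) (hY : h Y = l • Y) (hZ : h Z = l • Z) (hW : h W = l • W) :
    g (R X Y Z) W = (2 * (ε + l) - ε * μ) * (g Y Z * g X W - g X Z * g Y W) := by
  have hl2 : l ≠ -l := fun e => hl (by linarith)
  have hξ0 : h ξ = (0 : ℝ) • ξ := by rw [hh_ξ, zero_smul]
  have hφe : ∀ {A : V}, h A = l • A → h (φ A) = (-l) • φ A := fun hA => by
    rw [hhφ, hA, map_smul, neg_smul]
  have η0 : ∀ {A : V}, h A = l • A → η A = 0 := fun hA => by
    rw [hη, bilin_eq_zero_of_eigen hh_sym hl.symm hξ0 hA, mul_zero]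
  have orth : ∀ {A B : V}, h A = l • A → h B = l • B → g A (φ B) = 0 :=
    fun hA hB => bilin_eq_zero_of_eigen hh_sym hl2 hA (hφe hB)
  have orth' : ∀ {A B : V}, h A = l • A → h B = l • B → g (φ A) B = 0 :=
    fun hA hB => bilin_eq_zero_of_eigen hh_sym hl2.symm (hφe hA) hB
  have hξφW : g ξ (φ W) = 0 := bilin_eq_zero_of_eigen hh_sym
    (neg_ne_zero.mpr hl).symm hξ0 (hφe hW)
  have M1 := curvature_mixed_eigen hg_symm hη hφ_sq hφ_g hh_sym hh_ξ hhφ hhR hl hX hY hZ hW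
  have M2 := curvature_mixed_eigen hg_symm hη hφ_sq hφ_g hh_sym hh_ξ hhφ hhR hl hY hX hZ hW
  have B := congrArg (fun v => g v (φ W)) (hR_bianchi X Y (φ Z))
  have S := hR_skew1 (φ Z) X Y (φ W)
  have H := congrArg (fun v => g v (φ W)) (hφR X Y Z)
  simp only [hX, hY, η0 hX, η0 hY, η0 hZ, η0 hW, map_smul, map_add, map_sub,
    LinearMap.add_apply, LinearMap.sub_apply, LinearMap.smul_apply,
    smul_eq_mul, hφ_g, orth hX hW, orth hY hW, orth' hX hZ, orth' hY hZ, hξφW, zero_smul,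
    map_zero, LinearMap.zero_apply] at H B
  have hε2 : ε * ε = 1 := by rcases hε with rfl | rfl <;> norm_num
  have hc : (1 + ε * l) * (ε + l) = 2 * (ε + l) - κ := by
    linear_combination (l - κ) * hε2 + ε * hlsq
  linear_combination -H + B - M1 + M2 - S + (g Y Z * g X W - g X Z * g Y W) * hc

end Eigenvectors

theorem stmt_9
    {V : Type*} [AddCommGroup V] [Module ℝ V] [FiniteDimensional ℝ V]
    (n : ℕ) (hn : 1 ≤ n)
    (hdim : Module.finrank ℝ V = 2 * n + 1)
    (g : LinearMap.BilinForm ℝ V)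
    (hg_symm : ∀ X Y : V, g X Y = g Y X)
    (hg_nd : g.Nondegenerate)
    (ε : ℝ) (hε : ε = 1 ∨ ε = -1)
    (ξ : V) (hξ : g ξ ξ = ε)
    (η : V → ℝ) (hη : ∀ X : V, η X = ε * g ξ X)
    (φ : V →ₗ[ℝ] V)
    (hφ_sq : ∀ X : V, φ (φ X) = -X + η X • ξ)
    (hφ_g : ∀ X Y : V, g (φ X) (φ Y) = g X Y - ε * η X * η Y)
    (h : V →ₗ[ℝ] V)
    (hh_sym : ∀ X Y : V, g (h X) Y = g X (h Y))
    (hh_ξ : h ξ = 0)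
    (hhφ : ∀ X : V, h (φ X) = - φ (h X))
    (R : V →ₗ[ℝ] V →ₗ[ℝ] V →ₗ[ℝ] V)
    (hR_skew1 : ∀ X Y Z W : V, g (R X Y Z) W = - g (R Y X Z) W)
    (hR_skew2 : ∀ X Y Z W : V, g (R X Y Z) W = - g (R X Y W) Z)
    (hR_pair : ∀ X Y Z W : V, g (R X Y Z) W = g (R Z W X) Y)
    (hR_bianchi : ∀ X Y Z : V, R X Y Z + R Y Z X + R Z X Y = 0)
    (κ μ : ℝ)
    (hnull : ∀ X Y : V, R X Y ξ
      = (ε * κ) • (η Y • X - η X • Y) + (ε * μ) • (η Y • h X - η X • h Y))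
    (hφR : ∀ X Y Z : V, R X Y (φ Z) = φ (R X Y Z)
      + ((1 - ε * κ) * (η X * g (φ Y) Z - η Y * g (φ X) Z)
         + ε * (1 - μ) * (η X * g (φ (h Y)) Z - η Y * g (φ (h X)) Z)) • ξ
      - g (Y + ε • h Y) Z • (ε • φ X + φ (h X))
      + g (X + ε • h X) Z • (ε • φ Y + φ (h Y))
      - g (ε • φ Y + φ (h Y)) Z • (X + ε • h X)
      + g (ε • φ X + φ (h X)) Z • (Y + ε • h Y)
      - η Z • ((1 - ε * κ) • (η X • φ Y - η Y • φ X)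
         + (ε * (1 - μ)) • (η X • φ (h Y) - η Y • φ (h X))))
    (hhR : ∀ X Y Z : V, R X Y (h Z) - h (R X Y Z)
      = (κ * (η X * g (h Y) Z - η Y * g (h X) Z)
         + μ * (ε * κ - 1) * (η Y * g X Z - η X * g Y Z)) • ξ
      + κ • (g Y (φ Z) • φ (h X) - g X (φ Z) • φ (h Y) + g Z (φ (h Y)) • φ X
         - g Z (φ (h X)) • φ Y + (ε * η Z) • (η X • h Y - η Y • h X))
      - μ • (η Y • (((ε - κ) * η Z) • X + (μ * η X) • h Z)
         - η X • (((ε - κ) * η Z) • Y + (μ * η Y) • h Z)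
         + (2 * ε * g X (φ Y)) • φ (h Z)))
    (hκ : ε * κ < 1)
    (hh2 : ∀ X : V, h (h X) = (ε * κ - 1) • φ (φ X))
    (lam : ℝ) (hlam : lam = Real.sqrt (1 - ε * κ)) :
    (∀ X Y : V, h X = lam • X → h Y = lam • Y → g X X * g Y Y - g X Y ^ 2 ≠ 0 →
      g (R X Y Y) X / (g X X * g Y Y - g X Y ^ 2) = 2 * (ε + lam) - ε * μ) ∧
    (∀ X Y : V, h X = lam • X → h Y = (-lam) • Y → g X X * g Y Y ≠ 0 →
      g (R X Y Y) X / (g X X * g Y Y - g X Y ^ 2)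
        = -(κ + ε * μ) * g X (φ Y) ^ 2 / (g X X * g Y Y)) ∧
    (∀ X Y : V, h X = (-lam) • X → h Y = (-lam) • Y → g X X * g Y Y - g X Y ^ 2 ≠ 0 →
      g (R X Y Y) X / (g X X * g Y Y - g X Y ^ 2) = 2 * (ε - lam) - ε * μ) := by
  have hpos : 0 < lam := hlam ▸ Real.sqrt_pos.mpr (by linarith)
  have hsq : lam ^ 2 = 1 - ε * κ := hlam ▸ Real.sq_sqrt (by linarith)
  refine ⟨fun X Y hX hY hne => ?_, fun X Y hX hY hne => ?_, fun X Y hX hY hne => ?_⟩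
  · rw [div_eq_iff hne, curvature_eigen hg_symm hε hη hφ_sq hφ_g hh_sym hh_ξ hhφ hR_skew1
      hR_bianchi hφR hhR hpos.ne' hsq hX hY hY hX, hg_symm Y X]
    ring
  · have hne' : lam ≠ -lam := by linarith
    have hφY : h (φ Y) = lam • φ Y := by rw [hhφ, hY, map_smul, neg_smul, neg_neg]
    have hηY : η Y = 0 := by
      rw [hη, bilin_eq_zero_of_eigen hh_sym (neg_ne_zero.mpr hpos.ne').symm
        (by rw [hh_ξ, zero_smul]) hY, mul_zero]
    have M := curvature_mixed_eigen hg_symm hη hφ_sq hφ_g hh_sym hh_ξ hhφ hhR hpos.ne'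
      hX hX hφY hφY
    rw [hφ_sq, hηY, zero_smul, add_zero] at M
    simp only [map_neg, LinearMap.neg_apply, neg_neg] at M
    rw [bilin_eq_zero_of_eigen hh_sym hne' hX hY, hR_skew2, M]
    congr 1 <;> ring
  · rw [div_eq_iff hne, curvature_eigen hg_symm hε hη hφ_sq hφ_g hh_sym hh_ξ hhφ hR_skew1
      hR_bianchi hφR hhR (neg_ne_zero.mpr hpos.ne') (by rw [neg_sq, hsq]) hX hY hY hX, hg_symm Y X]
    ring
end

section
/- Suppose the data (V,g,ε,ξ,η,φ,h,R) satisfies the (κ,μ)-nullity condition and Identity (φR), and suppose there is c ∈ ℝ such that g(R(X,φX)φX,X) = c·g(X,X)² for all X ∈ V with η(X) = 0 (constant φ-sectional curvature c). Then for all X,Y,Z ∈ V: R(X,Y)Z = ((c+3ε)/4){g(Y,Z)X − g(X,Z)Y} + ((c−ε)/4){2g(X,φY)φZ + g(X,φZ)φY − g(Y,φZ)φX} + ((c+3ε)/4 − κ){εη(X)η(Z)Y − εη(Y)η(Z)X + η(Y)g(X,Z)ξ − η(X)g(Y,Z)ξ} + {−g(X,Z)hY − g(hX,Z)Y + g(Y,Z)hX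 + g(hY,Z)X} + (ε/2){−g(hX,Z)hY + g(hY,Z)hX + g(φhX,Z)φhY − g(φhY,Z)φhX} + (1−μ){εη(X)η(Z)hY + η(Y)g(hX,Z)ξ − εη(Y)η(Z)hX − η(X)g(hY,Z)ξ}. (Curvature-tensor formula of Theorem 3.9, equation (3.22).) -/
/-- A quadrilinear form with the symmetries of a curvature tensor vanishes as soon as its
sectional curvatures do. Additivity in the first slot is enough. -/
theorem curvatureForm_eq_zero_of_sectional {V : Type*} [AddCommGroup V] {F : V → V → V → V → ℝ}
    (add : ∀ X X' Y Z W, F (X + X') Y Z W = F X Y Z W + F X' Y Z W)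
    (skew₁ : ∀ X Y Z W, F X Y Z W = -F Y X Z W)
    (pair : ∀ X Y Z W, F X Y Z W = F Z W X Y)
    (bianchi : ∀ X Y Z W, F X Y Z W + F Y Z X W + F Z X Y W = 0)
    (sec : ∀ X Y, F X Y X Y = 0) (X Y Z W : V) : F X Y Z W = 0 := by
  have polar₂ (X Y W : V) : F X Y X W = 0 := by
    have key := sec X (Y + W)
    rw [skew₁, add, skew₁ Y, skew₁ W, pair X Y, pair X W, skew₁ X, skew₁ X (Y + W), add, add,
      skew₁ Y X X Y, skew₁ Y X X W, skew₁ W X X Y, skew₁ W X X W] at key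
    linarith [sec X Y, sec X W, pair X Y X W]
  have alt (X Y Z W : V) : F X Y Z W = -F Z Y X W := by
    have key := polar₂ (X + Z) Y W
    rw [add, pair, pair Z, add, add] at key
    linarith [polar₂ X Y W, polar₂ Z Y W, pair X W X Y, pair X W Z Y, pair Z W X Y,
      pair Z W Z Y]
  linarith [bianchi X Y Z W, alt Y Z X W, skew₁ X Z Y W, alt Z X Y W, skew₁ Y X Z W,
    skew₁ Z Y X W, alt X Y Z W]

/-- A curvature form of Kähler type with vanishing holomorphic sectional curvature is zero.
The endomorphism `J` only has to square to `-1` after insertion into the form. -/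
theorem curvatureForm_eq_zero_of_holomorphic {V : Type*} [AddCommGroup V]
    {F : V → V → V → V → ℝ} (J : V →+ V)
    (add : ∀ X X' Y Z W, F (X + X') Y Z W = F X Y Z W + F X' Y Z W)
    (skew₁ : ∀ X Y Z W, F X Y Z W = -F Y X Z W)
    (pair : ∀ X Y Z W, F X Y Z W = F Z W X Y)
    (bianchi : ∀ X Y Z W, F X Y Z W + F Y Z X W + F Z X Y W = 0)
    (J_sq : ∀ X Y Z W, F (J (J X)) Y Z W = -F X Y Z W)
    (J_skew : ∀ X Y Z W, F X Y (J Z) W = -F X Y Z (J W))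
    (hol : ∀ X, F X (J X) (J X) X = 0) (X Y Z W : V) : F X Y Z W = 0 := by
  have neg (X Y Z W : V) : F (-X) Y Z W = -F X Y Z W := by
    have h0 := add 0 0 Y Z W
    have h1 := add X (-X) Y Z W
    rw [add_zero] at h0
    rw [add_neg_cancel] at h1
    linarith
  have add₂ (X Y Y' Z W : V) : F X (Y + Y') Z W = F X Y Z W + F X Y' Z W := by
    rw [skew₁, add, skew₁ Y, skew₁ Y']; ring
  have add₃ (X Y Z Z' W : V) : F X Y (Z + Z') W = F X Y Z W + F X Y Z' W := by
    rw [pair, add, pair Z, pair Z']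
  have add₄ (X Y Z W W' : V) : F X Y Z (W + W') = F X Y Z W + F X Y Z W' := by
    rw [pair, add₂, pair Z, pair Z]
  have neg₂ (X Y Z W : V) : F X (-Y) Z W = -F X Y Z W := by
    rw [skew₁, neg, skew₁ Y]; ring
  have neg₃ (X Y Z W : V) : F X Y (-Z) W = -F X Y Z W := by
    rw [pair, neg, pair Z]
  have neg₄ (X Y Z W : V) : F X Y Z (-W) = -F X Y Z W := by
    rw [pair, neg₂, pair Z]
  have J_sq₂ (X Y Z W : V) : F X (J (J Y)) Z W = -F X Y Z W := by
    rw [skew₁, J_sq, skew₁ Y]; ring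
  have J_skew₁ (X Y Z W : V) : F (J X) Y Z W = -F X (J Y) Z W := by
    rw [pair, J_skew, pair Z]
  have polar (X Y : V) : F X (J X) Y (J Y) + 2 * F X (J Y) X (J Y) = 0 := by
    have hp := hol (X + Y)
    have hm := hol (X + -Y)
    simp only [map_add, map_neg, add, add₂, add₃, add₄, neg, neg₂, neg₃, neg₄, J_skew] at hp hm
    have hX := hol X
    have hY := hol Y
    simp only [J_skew] at hX hY
    have s (A B C D : V) : F A (J B) C D = F B (J A) C D := by
      linarith [J_skew₁ A B C D, skew₁ (J A) B C D]
    have s' (A B C D : V) : F A B C (J D) = F A B D (J C) := by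
      rw [pair, s, pair]
    linarith [s Y X X Y, s Y X Y X, s Y X X X, s Y X Y Y, s' X (J X) Y X, s' X (J Y) Y X,
      s' Y (J X) Y X, s' Y (J Y) Y X, pair X (J X) Y (J Y), s X Y X (J Y), s X Y Y (J X),
      s Y X X (J Y), s Y X Y (J X)]
  have relation (X Y : V) : 3 * F X (J Y) X (J Y) + F X Y X Y = 0 := by
    have hb := bianchi X (J X) Y (J Y)
    have h1 : F Y X (J X) (J Y) = -F X Y X Y := by
      rw [J_skew, pair, J_sq₂, neg_neg, pair, skew₁]
    linarith [polar X Y, J_skew₁ X Y X (J Y)]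
  refine curvatureForm_eq_zero_of_sectional add skew₁ pair bianchi (fun X Y => ?_) X Y Z W
  have h1 := relation X Y
  have h2 := relation X (J Y)
  rw [J_sq₂, pair, J_sq₂] at h2
  linarith

/-- The scalar form of the curvature tensor of a `(κ, μ)`-space of constant `φ`-sectional
curvature, in terms of the metric `g`, the form `ω X Y = g (φ X) Y`, and the forms
`a X Y = g (h X) Y` and `b X Y = g (φ (h X)) Y`. -/
noncomputable def modelForm {V : Type*} (g ω a b : V → V → ℝ) (η : V → ℝ) (ε κ μ c : ℝ) (X Y Z W : V) : ℝ :=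
  (c + 3 * ε) / 4 * (g Y Z * g X W - g X Z * g Y W)
  + (c - ε) / 4 * (-2 * ω X Y * ω Z W - ω X Z * ω Y W + ω Y Z * ω X W)
  + ((c + 3 * ε) / 4 - κ) * ε * (η X * η Z * g Y W - η Y * η Z * g X W
      + η Y * g X Z * η W - η X * g Y Z * η W)
  + (-(g X Z) * a Y W - a X Z * g Y W + g Y Z * a X W + a Y Z * g X W)
  + ε / 2 * (-(a X Z) * a Y W + a Y Z * a X W + b X Z * b Y W - b Y Z * b X W)
  + (1 - μ) * ε * (η X * η Z * a Y W + η Y * a X Z * η W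
      - η Y * η Z * a X W - η X * a Y Z * η W)

section modelForm

variable {V : Type*} {g ω a b : V → V → ℝ} {η : V → ℝ} {ε κ μ c : ℝ}

theorem modelForm_skew_left (hω : ∀ X Y, ω X Y = -ω Y X) (X Y Z W : V) :
    modelForm g ω a b η ε κ μ c X Y Z W = -modelForm g ω a b η ε κ μ c Y X Z W := by
  simp only [modelForm, hω Y X]
  ring

theorem modelForm_pair (hg : ∀ X Y, g X Y = g Y X) (hω : ∀ X Y, ω X Y = -ω Y X)
    (ha : ∀ X Y, a X Y = a Y X) (hb : ∀ X Y, b X Y = b Y X) (X Y Z W : V) :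
    modelForm g ω a b η ε κ μ c X Y Z W = modelForm g ω a b η ε κ μ c Z W X Y := by
  simp only [modelForm, hω Z X, hω Z Y, hω W X, hω W Y, hg Z X, hg Z Y, hg W X, hg W Y,
    ha Z X, ha Z Y, ha W X, ha W Y, hb Z X, hb Z Y, hb W X, hb W Y]
  ring

theorem modelForm_bianchi (hg : ∀ X Y, g X Y = g Y X) (hω : ∀ X Y, ω X Y = -ω Y X)
    (ha : ∀ X Y, a X Y = a Y X) (hb : ∀ X Y, b X Y = b Y X) (X Y Z W : V) :
    modelForm g ω a b η ε κ μ c X Y Z W + modelForm g ω a b η ε κ μ c Y Z X W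
      + modelForm g ω a b η ε κ μ c Z X Y W = 0 := by
  simp only [modelForm, hω Z X, hω Z Y, hω Y X, hg Z X, hg Z Y, hg Y X,
    ha Z X, ha Z Y, ha Y X, hb Z X, hb Z Y, hb Y X]
  ring

end modelForm


theorem stmt_11
    {V : Type*} [AddCommGroup V] [Module ℝ V] [FiniteDimensional ℝ V]
    (n : ℕ) (hn : 1 ≤ n)
    (hdim : Module.finrank ℝ V = 2 * n + 1)
    (g : LinearMap.BilinForm ℝ V)
    (hg_symm : ∀ X Y : V, g X Y = g Y X)
    (hg_nd : g.Nondegenerate)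
    (ε : ℝ) (hε : ε = 1 ∨ ε = -1)
    (ξ : V) (hξ : g ξ ξ = ε)
    (η : V → ℝ) (hη : ∀ X : V, η X = ε * g ξ X)
    (φ : V →ₗ[ℝ] V)
    (hφ_sq : ∀ X : V, φ (φ X) = -X + η X • ξ)
    (hφ_g : ∀ X Y : V, g (φ X) (φ Y) = g X Y - ε * η X * η Y)
    (h : V →ₗ[ℝ] V)
    (hh_sym : ∀ X Y : V, g (h X) Y = g X (h Y))
    (hh_ξ : h ξ = 0)
    (hhφ : ∀ X : V, h (φ X) = - φ (h X))
    (R : V →ₗ[ℝ] V →ₗ[ℝ] V →ₗ[ℝ] V)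
    (hR_skew1 : ∀ X Y Z W : V, g (R X Y Z) W = - g (R Y X Z) W)
    (hR_skew2 : ∀ X Y Z W : V, g (R X Y Z) W = - g (R X Y W) Z)
    (hR_pair : ∀ X Y Z W : V, g (R X Y Z) W = g (R Z W X) Y)
    (hR_bianchi : ∀ X Y Z : V, R X Y Z + R Y Z X + R Z X Y = 0)
    (κ μ : ℝ)
    (hnull : ∀ X Y : V, R X Y ξ
      = (ε * κ) • (η Y • X - η X • Y) + (ε * μ) • (η Y • h X - η X • h Y))
    (hφR : ∀ X Y Z : V, R X Y (φ Z) = φ (R X Y Z)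
      + ((1 - ε * κ) * (η X * g (φ Y) Z - η Y * g (φ X) Z)
         + ε * (1 - μ) * (η X * g (φ (h Y)) Z - η Y * g (φ (h X)) Z)) • ξ
      - g (Y + ε • h Y) Z • (ε • φ X + φ (h X))
      + g (X + ε • h X) Z • (ε • φ Y + φ (h Y))
      - g (ε • φ Y + φ (h Y)) Z • (X + ε • h X)
      + g (ε • φ X + φ (h X)) Z • (Y + ε • h Y)
      - η Z • ((1 - ε * κ) • (η X • φ Y - η Y • φ X)
         + (ε * (1 - μ)) • (η X • φ (h Y) - η Y • φ (h X))))
    (c : ℝ) (hc : ∀ X : V, η X = 0 → g (R X (φ X) (φ X)) X = c * g X X ^ 2) :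
    ∀ X Y Z : V, R X Y Z
      = ((c + 3 * ε) / 4) • (g Y Z • X - g X Z • Y)
      + ((c - ε) / 4) • ((2 * g X (φ Y)) • φ Z + g X (φ Z) • φ Y - g Y (φ Z) • φ X)
      + ((c + 3 * ε) / 4 - κ) • ((ε * η X * η Z) • Y - (ε * η Y * η Z) • X
          + (η Y * g X Z) • ξ - (η X * g Y Z) • ξ)
      + (-(g X Z) • h Y - g (h X) Z • Y + g Y Z • h X + g (h Y) Z • X)
      + (ε / 2) • (-(g (h X) Z) • h Y + g (h Y) Z • h X
          + g (φ (h X)) Z • φ (h Y) - g (φ (h Y)) Z • φ (h X))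
      + (1 - μ) • ((ε * η X * η Z) • h Y + (η Y * g (h X) Z) • ξ
          - (ε * η Y * η Z) • h X - (η X * g (h Y) Z) • ξ) := by
  have hεε : ε * ε = 1 := by rcases hε with rfl | rfl <;> norm_num
  have hgξ (X : V) : g ξ X = ε * η X := by
    rw [hη, ← mul_assoc, hεε, one_mul]
  have hηξ : η ξ = 1 := by rw [hη, hξ, hεε]
  have hφξ : φ ξ = 0 := by
    have h1 : φ (φ ξ) = 0 := by rw [hφ_sq, hηξ, one_smul, neg_add_cancel]
    have h2 := hφ_sq (φ ξ)
    rw [h1, map_zero] at h2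
    have h3 : φ ξ = η (φ ξ) • ξ := by
      rw [eq_comm, neg_add_eq_zero] at h2
      exact h2
    have h4 : η (φ ξ) * η (φ ξ) = 0 := by
      have := hφ_g ξ ξ
      rw [h3] at this
      simp only [map_smul, LinearMap.smul_apply, smul_eq_mul, hξ, hηξ] at this
      have hp : ε * (η (φ ξ) * η (φ ξ)) = 0 := by linarith
      linear_combination ε * hp - η (φ ξ) * η (φ ξ) * hεε
    rw [h3, mul_self_eq_zero.mp h4, zero_smul]
  have hηφ (X : V) : η (φ X) = 0 := by
    have h1 := hφ_g (φ X) ξ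
    rw [hφξ, map_zero, hηξ, hg_symm, hgξ] at h1
    have h2 : φ (φ (φ X)) = -φ X := by rw [hφ_sq X]; simp [hφξ]
    have h3 := hφ_sq (φ X)
    rw [h2, left_eq_add] at h3
    have h4 := congrArg η h3
    rw [hη, map_smul, hξ, hη 0, map_zero, smul_eq_mul] at h4
    linear_combination h4 - η (φ X) * hεε
  have hηh (X : V) : η (h X) = 0 := by
    rw [hη, ← hh_sym, hh_ξ]; simp
  have hφ_skew (X Y : V) : g X (φ Y) = -g (φ X) Y := by
    have h1 := hφ_g X (φ Y)
    rw [hφ_sq, hηφ] at h1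
    simp only [map_add, map_neg, map_smul, smul_eq_mul] at h1
    rw [hg_symm (φ X) ξ, hgξ, hηφ] at h1
    linarith
  let ω : V → V → ℝ := fun X Y => g (φ X) Y
  let a : V → V → ℝ := fun X Y => g (h X) Y
  let b : V → V → ℝ := fun X Y => g (φ (h X)) Y
  let γ : V → V → ℝ := fun X Y => g X Y
  have hω (X Y : V) : ω X Y = -ω Y X := by
    change g (φ X) Y = -g (φ Y) X
    rw [← hφ_skew, hg_symm]
  have ha (X Y : V) : a X Y = a Y X := by
    change g (h X) Y = g (h Y) X
    rw [hh_sym, hg_symm]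
  have hb (X Y : V) : b X Y = b Y X := by
    change g (φ (h X)) Y = g (φ (h Y)) X
    rw [hg_symm, hφ_skew, ← hh_sym, hhφ, map_neg, LinearMap.neg_apply, neg_neg]
  have hηadd (X Y : V) : η (X + Y) = η X + η Y := by
    rw [hη, hη, hη, map_add, mul_add]
  let F : V → V → V → V → ℝ := fun X Y Z W =>
    g (R X Y Z) W - modelForm γ ω a b η ε κ μ c X Y Z W
  have add (X X' Y Z W : V) : F (X + X') Y Z W = F X Y Z W + F X' Y Z W := by
    simp only [F, modelForm, γ, ω, a, b, map_add, LinearMap.add_apply, hηadd]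
    ring
  have skew (X Y Z W : V) : F X Y Z W = -F Y X Z W := by
    change g (R X Y Z) W - _ = -(g (R Y X Z) W - _)
    rw [hR_skew1, modelForm_skew_left hω]
    ring
  have pair (X Y Z W : V) : F X Y Z W = F Z W X Y := by
    change g (R X Y Z) W - _ = g (R Z W X) Y - _
    rw [hR_pair, modelForm_pair hg_symm hω ha hb]
  have bianchi (X Y Z W : V) : F X Y Z W + F Y Z X W + F Z X Y W = 0 := by
    have h1 := congrArg (fun T => g T W) (hR_bianchi X Y Z)
    simp only [map_add, LinearMap.add_apply, map_zero, LinearMap.zero_apply] at h1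
    linear_combination h1 - modelForm_bianchi (η := η) (ε := ε) (κ := κ) (μ := μ) (c := c)
      hg_symm hω ha hb X Y Z W
  have F_ξ (X Y Z : V) : F ξ X Y Z = 0 := by
    rw [pair]
    have hg (U : V) : g U ξ = ε * η U := by rw [hg_symm, hgξ]
    simp only [F, modelForm, γ, ω, a, b, hnull, hg, hηξ, hηφ, hηh, hφξ, map_add, map_sub, map_smul,
      map_zero, LinearMap.zero_apply, LinearMap.add_apply, LinearMap.sub_apply,
      LinearMap.smul_apply, smul_eq_mul]
    ring
  have F_smul_ξ (t : ℝ) (X Y Z : V) : F (t • ξ) X Y Z = 0 := by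
    have : F (t • ξ) X Y Z = t * F ξ X Y Z := by
      simp only [F, modelForm, γ, ω, a, b, map_smul, LinearMap.smul_apply, smul_eq_mul, hη]
      ring
    rw [this, F_ξ, mul_zero]
  have J_sq (X Y Z W : V) : F (φ (φ X)) Y Z W = -F X Y Z W := by
    have h1 := add X (φ (φ X)) Y Z W
    rw [hφ_sq, add_neg_cancel_left, F_smul_ξ, ← hφ_sq] at h1
    linarith
  have J_sq₂ (X Y Z W : V) : F X (φ (φ Y)) Z W = -F X Y Z W := by
    rw [skew, J_sq, skew Y, neg_neg]
  have J_sq₃ (X Y Z W : V) : F X Y (φ (φ Z)) W = -F X Y Z W := by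
    rw [pair, J_sq, pair]
  have J_sq₄ (X Y Z W : V) : F X Y Z (φ (φ W)) = -F X Y Z W := by
    rw [pair, J_sq₂, pair]
  have hφφ (X Y : V) (hX : η X = 0) : g (φ X) (φ Y) = g X Y := by
    rw [hφ_g, hX]; ring
  have J_skew_horizontal (X Y Z W : V) (hX : η X = 0) (hY : η Y = 0) (hZ : η Z = 0)
      (hW : η W = 0) : F X Y (φ Z) W = -F X Y Z (φ W) := by
    have h1 := congrArg (fun T => g T W) (hφR X Y Z)
    have h2 : φ (φ Z) = -Z := by rw [hφ_sq, hZ, zero_smul, add_zero]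
    simp only [hX, hY, hZ, zero_mul, mul_zero, sub_zero, add_zero, zero_smul, map_add,
      map_sub, map_smul, LinearMap.add_apply, LinearMap.sub_apply, LinearMap.smul_apply,
      smul_eq_mul] at h1
    have h3 := hφ_skew (R X Y Z) W
    simp only [F, modelForm, γ, ω, a, b, hX, hY, hZ, hW, hηφ, h2, hφφ X _ hX, hφφ Y _ hY,
      hφφ Z _ hZ, hφφ (h X) _ (hηh X), hφφ (h Y) _ (hηh Y), hφ_skew X, hφ_skew Y,
      hφ_skew (h X), hφ_skew (h Y), map_neg, LinearMap.neg_apply]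
    linear_combination h1 + h3 + (g (φ X) Z * g (h Y) W - g (φ Y) Z * g (h X) W
      + g (φ Y) W * g (h X) Z - g (φ X) W * g (h Y) Z) * hεε
  have J_skew (X Y Z W : V) : F X Y (φ Z) W = -F X Y Z (φ W) := by
    have h1 := J_skew_horizontal (φ (φ X)) (φ (φ Y)) (φ (φ Z)) (φ (φ W))
      (hηφ _) (hηφ _) (hηφ _) (hηφ _)
    rw [J_sq, J_sq, J_sq₂, J_sq₂, J_sq₃, J_sq₃, J_sq₄, J_sq₄] at h1
    linarith
  have hol_horizontal (X : V) (hX : η X = 0) : F X (φ X) (φ X) X = 0 := by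
    have h1 := hc X hX
    have hωX : g (φ X) X = 0 := by linarith [hω X X]
    have h2 : φ (φ X) = -X := by rw [hφ_sq, hX, zero_smul, add_zero]
    have ha' : g (h (φ X)) (φ X) = -g (h X) X := by
      rw [hhφ, map_neg, LinearMap.neg_apply, hφφ _ _ (hηh X)]
    have hb' : g (φ (h (φ X))) X = g (h X) X := by
      rw [hhφ, map_neg, hφ_sq, hηh, zero_smul, add_zero, neg_neg]
    have hb'' : g (φ (h (φ X))) (φ X) = g (h (φ X)) X := hφφ _ _ (hηh _)
    have hγX : g X (φ X) = 0 := by rw [hg_symm, hωX]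
    have ha'' : g (h X) (φ X) = g (h (φ X)) X := by rw [hh_sym (φ X), hg_symm]
    have hb₃ : g (φ (h X)) (φ X) = g (h X) X := hφφ _ _ (hηh X)
    have hb₄ : g (φ (h X)) X = -g (h (φ X)) X := by rw [hhφ]; simp
    simp only [F, modelForm, γ, ω, a, b, h1, h2, ha', hb', hb'', hγX, ha'', hb₃, hb₄, hωX,
      hφφ X X hX, hX, hηφ, map_neg, LinearMap.neg_apply]
    ring
  have hol (X : V) : F X (φ X) (φ X) X = 0 := by
    rw [← hol_horizontal (φ X) (hηφ X), J_sq₂, J_sq₃, neg_neg, skew, pair, skew, pair, neg_neg]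
  have F_zero := curvatureForm_eq_zero_of_holomorphic φ.toAddMonoidHom add skew pair bianchi J_sq
    J_skew hol
  intro X Y Z
  rw [← sub_eq_zero]
  refine hg_nd.1 _ fun W => ?_
  rw [← F_zero X Y Z W]
  simp only [F, modelForm, γ, ω, a, b, map_add, map_sub, map_smul,
    LinearMap.add_apply, LinearMap.sub_apply, LinearMap.smul_apply,
    smul_eq_mul, hgξ, hφ_skew]
  ring
end

section
/- Suppose n > 1, the data (V,g,ε,ξ,η,φ,h,R) satisfies the (κ,μ)-nullity condition, Identity (φR), Identity (hR), εκ < 1 and h² = (εκ−1)φ², and suppose there is c ∈ ℝ such that g(R(X,φX)φX,X) = c·g(X,X)² for all X ∈ V with η(X) = 0 (constant φ-sectional curvature c). Then μ = εκ + 1 and c = −2κ − ε. (Final assertion of Theorem 3.9.) -/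
/-- A symmetric bilinear form that separates the points of a subspace of dimension at least two has
a nonzero Gram determinant on some pair of vectors of that subspace. -/
theorem exists_gram_ne_zero {V : Type*} [AddCommGroup V] [Module ℝ V] [FiniteDimensional ℝ V]
    (g : LinearMap.BilinForm ℝ V) (hg_symm : ∀ X Y : V, g X Y = g Y X) (E : Submodule ℝ V)
    (hE : ∀ x ∈ E, (∀ y ∈ E, g x y = 0) → x = 0) (hdim : 1 < Module.finrank ℝ E) :
    ∃ x ∈ E, ∃ y ∈ E, g x x * g y y - g x y ^ 2 ≠ 0 := by
  by_contra! hcon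
  have hpolar : ∀ F : Submodule ℝ V, (∀ z ∈ F, g z z = 0) → ∀ z ∈ F, ∀ w ∈ F, g z w = 0 := by
    intro F hF z hz w hw
    have hzw := hF _ (F.add_mem hz hw)
    simp only [map_add, LinearMap.add_apply, hF z hz, hF w hw, hg_symm w z] at hzw
    linarith
  suffices hspan : ∃ x, E ≤ Submodule.span ℝ {x} by
    obtain ⟨x, hx⟩ := hspan
    have h₁ := Submodule.finrank_mono hx
    have h₂ := finrank_span_le_card (R := ℝ) ({x} : Set V)
    simp only [Set.toFinset_singleton, Finset.card_singleton] at h₂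
    omega
  by_cases hiso : ∀ z ∈ E, g z z = 0
  · exact ⟨0, fun z hz => by rw [hE z hz (hpolar E hiso z hz)]; exact Submodule.zero_mem _⟩
  push Not at hiso
  obtain ⟨x, hx, hxx⟩ := hiso
  refine ⟨x, fun z hz => ?_⟩
  have hperp : ∀ u ∈ E, g x (u - (g x u / g x x) • x) = 0 := by
    intro u _
    simp only [map_sub, map_smul, smul_eq_mul]
    field_simp
    ring
  have hmem : ∀ u ∈ E, u - (g x u / g x x) • x ∈ E ⊓ LinearMap.ker (g x) := fun u hu =>
    ⟨E.sub_mem hu (E.smul_mem _ hx), hperp u hu⟩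
  have hnull := hpolar (E ⊓ LinearMap.ker (g x)) fun u hu => by
    have hu' : g x u = 0 := hu.2
    simpa [hu', hxx] using hcon x hx u hu.1
  have hz0 : z - (g x z / g x x) • x = 0 := by
    refine hE _ (hmem z hz).1 fun y hy => ?_
    have hsplit : y = (y - (g x y / g x x) • x) + (g x y / g x x) • x := by abel
    rw [hsplit, map_add, hnull _ (hmem z hz) _ (hmem y hy), map_smul,
      hg_symm (z - (g x z / g x x) • x) x, hperp z hz, smul_zero, add_zero]
  rw [sub_eq_zero.mp hz0]
  exact Submodule.smul_mem _ _ (Submodule.mem_span_singleton_self x)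


theorem stmt_12
    {V : Type*} [AddCommGroup V] [Module ℝ V] [FiniteDimensional ℝ V]
    (n : ℕ) (hn : 1 ≤ n)
    (hdim : Module.finrank ℝ V = 2 * n + 1)
    (g : LinearMap.BilinForm ℝ V)
    (hg_symm : ∀ X Y : V, g X Y = g Y X)
    (hg_nd : g.Nondegenerate)
    (ε : ℝ) (hε : ε = 1 ∨ ε = -1)
    (ξ : V) (hξ : g ξ ξ = ε)
    (η : V → ℝ) (hη : ∀ X : V, η X = ε * g ξ X)
    (φ : V →ₗ[ℝ] V)
    (hφ_sq : ∀ X : V, φ (φ X) = -X + η X • ξ)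
    (hφ_g : ∀ X Y : V, g (φ X) (φ Y) = g X Y - ε * η X * η Y)
    (h : V →ₗ[ℝ] V)
    (hh_sym : ∀ X Y : V, g (h X) Y = g X (h Y))
    (hh_ξ : h ξ = 0)
    (hhφ : ∀ X : V, h (φ X) = - φ (h X))
    (hn1 : 1 < n)
    (R : V →ₗ[ℝ] V →ₗ[ℝ] V →ₗ[ℝ] V)
    (hR_skew1 : ∀ X Y Z W : V, g (R X Y Z) W = - g (R Y X Z) W)
    (hR_skew2 : ∀ X Y Z W : V, g (R X Y Z) W = - g (R X Y W) Z)
    (hR_pair : ∀ X Y Z W : V, g (R X Y Z) W = g (R Z W X) Y)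
    (hR_bianchi : ∀ X Y Z : V, R X Y Z + R Y Z X + R Z X Y = 0)
    (κ μ : ℝ)
    (hnull : ∀ X Y : V, R X Y ξ
      = (ε * κ) • (η Y • X - η X • Y) + (ε * μ) • (η Y • h X - η X • h Y))
    (hφR : ∀ X Y Z : V, R X Y (φ Z) = φ (R X Y Z)
      + ((1 - ε * κ) * (η X * g (φ Y) Z - η Y * g (φ X) Z)
         + ε * (1 - μ) * (η X * g (φ (h Y)) Z - η Y * g (φ (h X)) Z)) • ξ
      - g (Y + ε • h Y) Z • (ε • φ X + φ (h X))
      + g (X + ε • h X) Z • (ε • φ Y + φ (h Y))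
      - g (ε • φ Y + φ (h Y)) Z • (X + ε • h X)
      + g (ε • φ X + φ (h X)) Z • (Y + ε • h Y)
      - η Z • ((1 - ε * κ) • (η X • φ Y - η Y • φ X)
         + (ε * (1 - μ)) • (η X • φ (h Y) - η Y • φ (h X))))
    (hhR : ∀ X Y Z : V, R X Y (h Z) - h (R X Y Z)
      = (κ * (η X * g (h Y) Z - η Y * g (h X) Z)
         + μ * (ε * κ - 1) * (η Y * g X Z - η X * g Y Z)) • ξ
      + κ • (g Y (φ Z) • φ (h X) - g X (φ Z) • φ (h Y) + g Z (φ (h Y)) • φ X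
         - g Z (φ (h X)) • φ Y + (ε * η Z) • (η X • h Y - η Y • h X))
      - μ • (η Y • (((ε - κ) * η Z) • X + (μ * η X) • h Z)
         - η X • (((ε - κ) * η Z) • Y + (μ * η Y) • h Z)
         + (2 * ε * g X (φ Y)) • φ (h Z)))
    (hκ : ε * κ < 1)
    (hh2 : ∀ X : V, h (h X) = (ε * κ - 1) • φ (φ X))
    (c : ℝ) (hc : ∀ X : V, η X = 0 → g (R X (φ X) (φ X)) X = c * g X X ^ 2) :
    μ = ε * κ + 1 ∧ c = -2 * κ - ε := by
  have hεε : ε * ε = 1 := by rcases hε with rfl | rfl <;> norm_num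
  have hε0 : ε ≠ 0 := left_ne_zero_of_mul_eq_one hεε
  have hξ0 : ξ ≠ 0 := by
    rintro rfl
    simp at hξ
    exact hε0 hξ.symm
  have hηξ : η ξ = 1 := by rw [hη, hξ, hεε]
  have hφξ : φ ξ = 0 := by
    have h₂ : φ (φ ξ) = 0 := by rw [hφ_sq, hηξ]; simp
    have h₃ : φ ξ = η (φ ξ) • ξ := by
      have h₄ := hφ_sq (φ ξ)
      rw [h₂, map_zero] at h₄
      exact (neg_add_eq_zero.mp h₄.symm)
    have h₅ : η (φ ξ) = 0 := by
      generalize η (φ ξ) = a at h₃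
      rw [h₃, map_smul, h₃, smul_smul] at h₂
      simpa [hξ0] using h₂
    rw [h₃, h₅, zero_smul]
  have hηφ : ∀ X, η (φ X) = 0 := by
    intro X
    have h₁ := hφ_sq (φ X)
    rw [hφ_sq X, map_add, map_smul, hφξ, map_neg, smul_zero, add_zero] at h₁
    simpa [hξ0] using h₁
  have hφ_skew : ∀ X Y, g (φ X) Y = -g X (φ Y) := by
    intro X Y
    have h₁ := hφ_g (φ X) Y
    have h₂ : g ξ (φ Y) = 0 := by simpa [hη, hε0] using hηφ Y
    rw [hηφ, hφ_sq] at h₁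
    simp only [map_add, map_neg, map_smul, LinearMap.add_apply, LinearMap.neg_apply,
      LinearMap.smul_apply, h₂, smul_eq_mul] at h₁
    linarith
  have hηh : ∀ X, η (h X) = 0 := by
    intro X
    rw [hη, ← hh_sym, hh_ξ]
    simp
  obtain ⟨l, hl, hll⟩ : ∃ l : ℝ, 0 < l ∧ l * l = 1 - ε * κ :=
    ⟨√(1 - ε * κ), Real.sqrt_pos.mpr (by linarith), Real.mul_self_sqrt (by linarith)⟩
  have hl0 : l ≠ 0 := hl.ne'
  let E : Submodule ℝ V := LinearMap.ker (h - l • LinearMap.id)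
  have hmemE : ∀ x, x ∈ E ↔ h x = l • x := by
    intro x
    simp [E, sub_eq_zero]
  have hηE : ∀ x ∈ E, η x = 0 := by
    intro x hx
    have h₁ := hηh x
    rw [(hmemE x).mp hx, hη, map_smul, smul_eq_mul] at h₁
    rw [hη]
    have h₂ : l * (ε * g ξ x) = 0 := by linarith
    simpa [hl0] using h₂
  have hhE : ∀ x ∈ E, h (φ x) = -(l • φ x) := by
    intro x hx
    rw [hhφ, (hmemE x).mp hx, map_smul]
  have horth : ∀ x ∈ E, ∀ y ∈ E, g x (φ y) = 0 := by
    intro x hx y hy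
    have h₁ := hh_sym x (φ y)
    rw [(hmemE x).mp hx, hhE y hy] at h₁
    simp only [map_smul, map_neg, LinearMap.smul_apply, smul_eq_mul] at h₁
    have h₂ : l * g x (φ y) = 0 := by linarith
    simpa [hl0] using h₂
  have hφφE : ∀ x ∈ E, φ (φ x) = -x := by
    intro x hx
    rw [hφ_sq, hηE x hx]
    simp
  have hηadd : ∀ X Y, η (X + Y) = η X + η Y := fun X Y => by simp only [hη, map_add, mul_add]
  have hηsmul : ∀ (a : ℝ) X, η (a • X) = a * η X := fun a X => by
    simp only [hη, map_smul, smul_eq_mul]; ring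
  have hplus : ∀ v, η v = 0 → v + l⁻¹ • h v ∈ E := by
    intro v hv
    have hhv : h (h v) = (l * l) • v := by
      rw [hh2, hφ_sq, hv, hll]
      module
    rw [hmemE, map_add, map_smul, hhv, smul_add, smul_smul, smul_smul, mul_inv_cancel₀ hl0,
      inv_mul_cancel_left₀ hl0, one_smul, add_comm]
  have hdecomp : ∀ v, ∃ x ∈ E, ∃ y ∈ E, v = η v • ξ + x + φ y := by
    intro v
    obtain ⟨w, hvw⟩ : ∃ w, w = v + (-η v) • ξ := ⟨_, rfl⟩
    have hw : η w = 0 := by rw [hvw, hηadd, hηsmul, hηξ]; ring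
    refine ⟨_, E.smul_mem (1 / 2) (hplus w hw), _, E.smul_mem (-1 / 2) (hplus _ (hηφ w)), ?_⟩
    have h₁ : φ (h (φ w)) = h w := by
      rw [hhφ, map_neg, hφ_sq, hηh]
      simp
    have hv : v = w + η v • ξ := by rw [hvw]; module
    rw [map_smul, map_add, map_smul, h₁, hφ_sq, hw]
    nth_rewrite 1 [hv]
    module
  have hEnd : ∀ x ∈ E, (∀ y ∈ E, g x y = 0) → x = 0 := by
    intro x hx hxE
    refine hg_nd.1 x fun v => ?_
    obtain ⟨y, hy, z, hz, hv⟩ := hdecomp v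
    have hxξ : g x ξ = 0 := by
      have := hηE x hx
      rw [hη] at this
      rw [hg_symm]
      simpa [hε0] using this
    rw [hv, map_add, map_add, map_smul, hxξ, hxE y hy, horth x hx z hz]
    simp
  have hEdim : 1 < Module.finrank ℝ E := by
    have htop : (⊤ : Submodule ℝ V) ≤ (Submodule.span ℝ {ξ} ⊔ E) ⊔ E.map φ := by
      intro v _
      obtain ⟨x, hx, y, hy, hv⟩ := hdecomp v
      rw [hv]
      exact Submodule.add_mem_sup (Submodule.add_mem_sup
        (Submodule.smul_mem _ _ (Submodule.mem_span_singleton_self ξ)) hx)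
        (Submodule.mem_map_of_mem hy)
    have h₁ := Submodule.finrank_mono htop
    rw [finrank_top, hdim] at h₁
    have h₂ := Submodule.finrank_add_le_finrank_add_finrank (Submodule.span ℝ {ξ} ⊔ E) (E.map φ)
    have h₃ := Submodule.finrank_add_le_finrank_add_finrank (Submodule.span ℝ {ξ}) E
    have h₄ := finrank_span_le_card (R := ℝ) ({ξ} : Set V)
    simp only [Set.toFinset_singleton, Finset.card_singleton] at h₄
    have h₅ := Submodule.finrank_map_le φ E
    omega
  obtain ⟨x, hx, y, hy, hxy⟩ := exists_gram_ne_zero g hg_symm E hEnd hEdim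
  have hφφg : ∀ u ∈ E, ∀ v ∈ E, g (φ u) (φ v) = g u v := fun u hu v hv => by
    rw [hφ_g, hηE u hu]; ring
  have horth' : ∀ u ∈ E, ∀ v ∈ E, g (φ u) v = 0 := fun u hu v hv => by
    rw [hg_symm, horth v hv u hu]
  have hmixed : ∀ a ∈ E, ∀ b ∈ E, ∀ u ∈ E, ∀ v ∈ E,
      g (R (φ a) b (φ u)) v = κ * g b u * g a v + ε * μ * g a b * g u v := by
    intro a ha b hb u hu v hv
    have h₁ := congrArg (fun w => g w v) (hhR (φ a) b (φ u))
    simp only [hηφ, hηE b hb, hhE a ha, hhE u hu, (hmemE b).mp hb, hφφE a ha, hφφE u hu,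
      map_sub, map_add, map_neg, map_smul, LinearMap.sub_apply, LinearMap.add_apply,
      LinearMap.neg_apply, LinearMap.smul_apply, smul_eq_mul, hh_sym, (hmemE v).mp hv,
      hφφg a ha b hb, hφφg u hu b hb, horth' a ha u hu, horth' u hu a ha,
      horth' b hb v hv, hg_symm u b] at h₁
    refine mul_left_cancel₀ (mul_ne_zero two_ne_zero hl0) ?_
    linear_combination -h₁
  have hbianchi : ∀ a ∈ E, ∀ b ∈ E,
      g (R (φ b) (φ a) b) a = (ε * μ - κ) * (g a a * g b b - g a b ^ 2) := by
    intro a ha b hb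
    have h₁ := congrArg (fun w => g w a) (hR_bianchi (φ b) (φ a) b)
    simp only [map_add, LinearMap.add_apply, map_zero, LinearMap.zero_apply] at h₁
    rw [hR_skew1 b, hmixed a ha b hb b hb a ha, hmixed b hb b hb a ha a ha, hg_symm b a] at h₁
    linear_combination h₁
  have hgauss₁ : ∀ a ∈ E, ∀ b ∈ E, g (R a b b) a
      = (κ - ε * μ + (1 + ε * l) * (ε + l)) * (g a a * g b b - g a b ^ 2) := by
    intro a ha b hb
    have h₁ := congrArg (fun w => g w (φ a)) (hφR a b b)
    simp only [hηE a ha, hηE b hb, (hmemE a).mp ha, (hmemE b).mp hb,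
      map_sub, map_add, map_smul, LinearMap.sub_apply, LinearMap.add_apply,
      LinearMap.smul_apply, smul_eq_mul, hφ_g,
      horth a ha a ha, horth b hb a ha, horth' a ha b hb, horth' b hb b hb] at h₁
    rw [hR_pair, hR_skew2, hbianchi a ha b hb, hg_symm b a] at h₁
    linear_combination -h₁
  have hgauss₂ : ∀ a ∈ E, ∀ b ∈ E, g (R (φ a) (φ b) (φ b)) (φ a)
      = (κ - ε * μ + (1 - ε * l) * (ε - l)) * (g a a * g b b - g a b ^ 2) := by
    intro a ha b hb
    have h₁ := congrArg (fun w => g w a) (hφR (φ a) (φ b) (φ b))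
    simp only [hηφ, hhE a ha, hhE b hb, hφφE a ha, hφφE b hb,
      map_sub, map_add, map_neg, map_smul, LinearMap.sub_apply, LinearMap.add_apply,
      LinearMap.neg_apply, LinearMap.smul_apply, smul_eq_mul, hφ_skew (R _ _ _),
      hφφg a ha b hb, hφφg b hb b hb,
      horth a ha b hb, horth b hb b hb, horth' a ha a ha, horth' b hb a ha] at h₁
    rw [hR_skew1, hbianchi a ha b hb, hg_symm b a] at h₁
    linear_combination h₁
  have hc_eigen : ∀ u ∈ E, (c + κ + ε * μ) * g u u ^ 2 = 0 := by
    intro u hu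
    have h₁ := hc u (hηE u hu)
    rw [hR_skew1, hmixed u hu u hu u hu u hu] at h₁
    linear_combination -h₁
  have hc_eq : c + κ + ε * μ = 0 := by
    by_contra hne
    have hzero : ∀ u ∈ E, g u u = 0 := fun u hu => by simpa [hne] using hc_eigen u hu
    have h₁ := hzero _ (E.add_mem hx hy)
    simp only [map_add, LinearMap.add_apply, hzero x hx, hzero y hy, hg_symm y x] at h₁
    have h₂ : g x y = 0 := by linarith
    exact hxy (by rw [hzero x hx, h₂]; ring)
  have hηxy : η (x + φ y) = 0 := by rw [hηadd, hηE x hx, hηφ, add_zero]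
  have hηxy' : η (x + φ (-y)) = 0 := by rw [hηadd, hηE x hx, hηφ, add_zero]
  have hsum := congrArg₂ (· + ·) (hc _ hηxy) (hc _ hηxy')
  simp only [map_add, map_neg, LinearMap.add_apply, LinearMap.neg_apply, hφφE y hy,
    hφφg y hy y hy, horth x hx y hy, horth' y hy x hx] at hsum
  have hy_eigen : g (R (φ y) y y) (φ y) = c * g y y ^ 2 := by
    rw [← hc y (hηE y hy), hR_skew1, hR_skew2, neg_neg]
  have hmixed' : g (R x (φ x) y) (φ y) = κ * g y x * g y x + ε * μ * g y y * g x x := by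
    rw [hR_pair, hR_skew1, hR_skew2, neg_neg, hmixed y hy y hy x hx x hx]
  have hbianchi' : g (R x y (φ x)) (φ y) = (ε * μ - κ) * (g x x * g y y - g x y ^ 2) := by
    rw [hR_pair, hR_skew1, hR_skew2, neg_neg, hbianchi x hx y hy]
  have hgauss₂' : g (R (φ y) (φ x) (φ x)) (φ y)
      = (κ - ε * μ + (1 - ε * l) * (ε - l)) * (g y y * g x x - g y x ^ 2) :=
    hgauss₂ y hy x hx
  have hμ : (κ + ε - ε * μ) * (g x x * g y y - g x y ^ 2) = 0 := by
    have hyx := hmixed y hy y hy x hx x hx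
    rw [hg_symm y x] at hmixed' hgauss₂' hyx
    linear_combination (1 / 8) * hsum - (1 / 4) * (hc x (hηE x hx) + hy_eigen
      - hyx - hmixed' - hbianchi x hx y hy - hbianchi'
      + hgauss₁ x hx y hy + hgauss₂') + (1 / 2) * g x x * g y y * hc_eq
      - (ε / 2) * (g x x * g y y - g x y ^ 2) * hll
      + (κ / 2) * (g x x * g y y - g x y ^ 2) * hεε
  have hμ' : κ + ε - ε * μ = 0 := (mul_eq_zero.mp hμ).resolve_right hxy
  constructor
  · linear_combination (-ε) * hμ' + (1 - μ) * hεε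
  · linear_combination hc_eq + hμ'
end

section
/- Suppose n > 1, the data (V,g,ε,ξ,η,φ,h,R) satisfies the (κ,μ)-nullity condition, Identity (φR), Identity (hR), εκ < 1 and h² = (εκ−1)φ². Then the following are equivalent: (a) there exists c ∈ ℝ such that g(R(X,φX)φX,X) = c·g(X,X)² for all X ∈ V with η(X) = 0 (constant φ-sectional curvature); (b) μ = εκ + 1. Moreover, in that case c = −(κ + εμ) = −2κ − ε. (Theorem 3.10.) -/
/-- The pointwise algebraic model of a `(κ, μ)`-contact pseudo-metric manifold, with the two curvature
identities for `φ` and `h`. -/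
structure IsKappaMuModel {V : Type*} [AddCommGroup V] [Module ℝ V] (g : LinearMap.BilinForm ℝ V)
    (ε : ℝ) (ξ : V) (η : V → ℝ) (φ h : V →ₗ[ℝ] V) (R : V →ₗ[ℝ] V →ₗ[ℝ] V →ₗ[ℝ] V)
    (κ μ : ℝ) : Prop where
  symm : ∀ X Y : V, g X Y = g Y X
  nondegenerate : g.Nondegenerate
  sign : ε = 1 ∨ ε = -1
  norm_xi : g ξ ξ = ε
  eta_apply : ∀ X : V, η X = ε * g ξ X
  phi_phi : ∀ X : V, φ (φ X) = -X + η X • ξ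
  phi_isometry : ∀ X Y : V, g (φ X) (φ Y) = g X Y - ε * η X * η Y
  h_symm : ∀ X Y : V, g (h X) Y = g X (h Y)
  h_xi : h ξ = 0
  h_phi : ∀ X : V, h (φ X) = - φ (h X)
  skew_left : ∀ X Y Z W : V, g (R X Y Z) W = - g (R Y X Z) W
  skew_right : ∀ X Y Z W : V, g (R X Y Z) W = - g (R X Y W) Z
  pair_symm : ∀ X Y Z W : V, g (R X Y Z) W = g (R Z W X) Y
  bianchi : ∀ X Y Z : V, R X Y Z + R Y Z X + R Z X Y = 0
  phi_curvature : ∀ X Y Z : V, R X Y (φ Z) = φ (R X Y Z)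
      + ((1 - ε * κ) * (η X * g (φ Y) Z - η Y * g (φ X) Z)
         + ε * (1 - μ) * (η X * g (φ (h Y)) Z - η Y * g (φ (h X)) Z)) • ξ
      - g (Y + ε • h Y) Z • (ε • φ X + φ (h X))
      + g (X + ε • h X) Z • (ε • φ Y + φ (h Y))
      - g (ε • φ Y + φ (h Y)) Z • (X + ε • h X)
      + g (ε • φ X + φ (h X)) Z • (Y + ε • h Y)
      - η Z • ((1 - ε * κ) • (η X • φ Y - η Y • φ X)
         + (ε * (1 - μ)) • (η X • φ (h Y) - η Y • φ (h X)))
  h_curvature : ∀ X Y Z : V, R X Y (h Z) - h (R X Y Z)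
      = (κ * (η X * g (h Y) Z - η Y * g (h X) Z)
         + μ * (ε * κ - 1) * (η Y * g X Z - η X * g Y Z)) • ξ
      + κ • (g Y (φ Z) • φ (h X) - g X (φ Z) • φ (h Y) + g Z (φ (h Y)) • φ X
         - g Z (φ (h X)) • φ Y + (ε * η Z) • (η X • h Y - η Y • h X))
      - μ • (η Y • (((ε - κ) * η Z) • X + (μ * η X) • h Z)
         - η X • (((ε - κ) * η Z) • Y + (μ * η Y) • h Z)
         + (2 * ε * g X (φ Y)) • φ (h Z))
  kappa_lt : ε * κ < 1
  h_h : ∀ X : V, h (h X) = (ε * κ - 1) • φ (φ X)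

namespace IsKappaMuModel

variable {V : Type*} [AddCommGroup V] [Module ℝ V] {g : LinearMap.BilinForm ℝ V}
  {ε : ℝ} {ξ : V} {η : V → ℝ} {φ h : V →ₗ[ℝ] V} {R : V →ₗ[ℝ] V →ₗ[ℝ] V →ₗ[ℝ] V} {κ μ : ℝ}

theorem sign_mul_self (H : IsKappaMuModel g ε ξ η φ h R κ μ) : ε * ε = 1 := by
  rcases H.sign with h | h <;> rw [h] <;> norm_num

theorem sign_ne_zero (H : IsKappaMuModel g ε ξ η φ h R κ μ) : ε ≠ 0 := by
  rcases H.sign with h | h <;> rw [h] <;> norm_num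

theorem eta_eq_zero_iff (H : IsKappaMuModel g ε ξ η φ h R κ μ) (X : V) : η X = 0 ↔ g ξ X = 0 := by
  rw [H.eta_apply, mul_eq_zero, or_iff_right H.sign_ne_zero]

theorem eta_add (H : IsKappaMuModel g ε ξ η φ h R κ μ) (X Y : V) : η (X + Y) = η X + η Y := by
  simp only [H.eta_apply, map_add]; ring

theorem eta_smul (H : IsKappaMuModel g ε ξ η φ h R κ μ) (a : ℝ) (X : V) : η (a • X) = a * η X := by
  simp only [H.eta_apply, map_smul, smul_eq_mul]; ring

theorem eta_xi (H : IsKappaMuModel g ε ξ η φ h R κ μ) : η ξ = 1 := by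
  rw [H.eta_apply, H.norm_xi, H.sign_mul_self]

theorem eq_zero_of_forall (H : IsKappaMuModel g ε ξ η φ h R κ μ)
    {X : V} (hX : ∀ Y, g X Y = 0) : X = 0 :=
  H.nondegenerate.1 X hX

theorem phi_xi (H : IsKappaMuModel g ε ξ η φ h R κ μ) : φ ξ = 0 := by
  have h1 : φ (φ ξ) = 0 := by rw [H.phi_phi, H.eta_xi]; simp
  have h2 := H.phi_phi (φ ξ)
  rw [h1, map_zero] at h2
  have h3 : φ ξ = η (φ ξ) • ξ := by
    rw [← sub_eq_zero, ← neg_eq_zero, neg_sub, sub_eq_neg_add, ← h2]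
  have h4 : η (φ ξ) * η (φ ξ) = 0 := by
    have h5 : (η (φ ξ) * η (φ ξ)) • ξ = 0 := by
      rw [← smul_smul, ← h3, ← map_smul, ← h3, h1]
    have := congrArg η h5
    rw [H.eta_smul, H.eta_xi, mul_one, H.eta_apply 0, map_zero, mul_zero] at this
    exact this
  rw [h3, mul_self_eq_zero.1 h4, zero_smul]

theorem eta_phi (H : IsKappaMuModel g ε ξ η φ h R κ μ) (X : V) : η (φ X) = 0 := by
  have h1 := H.phi_phi (φ X)
  rw [H.phi_phi X, map_add, map_neg, map_smul, H.phi_xi, smul_zero, add_zero] at h1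
  have h2 := congrArg η (add_eq_left.1 h1.symm)
  rw [H.eta_smul, H.eta_xi, mul_one, H.eta_apply 0] at h2
  simpa using h2

theorem phi_skew (H : IsKappaMuModel g ε ξ η φ h R κ μ) (X Y : V) : g (φ X) Y = -g X (φ Y) := by
  have h1 := H.phi_isometry X (φ Y)
  rw [H.phi_phi, H.eta_phi, map_add, map_neg, map_smul, H.symm (φ X) ξ,
    (H.eta_eq_zero_iff _).1 (H.eta_phi X)] at h1
  simp only [smul_zero, mul_zero, add_zero, sub_zero] at h1
  linarith

theorem eta_h (H : IsKappaMuModel g ε ξ η φ h R κ μ) (X : V) : η (h X) = 0 := by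
  rw [H.eta_apply, ← H.h_symm, H.h_xi]; simp

/-- `X` is horizontal and an eigenvector (possibly zero) of `h` for `a`. -/
def HorizontalEigen (η : V → ℝ) (h : V →ₗ[ℝ] V) (a : ℝ) (X : V) : Prop :=
  η X = 0 ∧ h X = a • X

theorem horizontalEigen_phi (H : IsKappaMuModel g ε ξ η φ h R κ μ)
    {a : ℝ} {X : V} (hX : HorizontalEigen η h a X) :
    HorizontalEigen η h (-a) (φ X) :=
  ⟨H.eta_phi X, by rw [H.h_phi, hX.2, map_smul, neg_smul]⟩

theorem horizontalEigen_add (H : IsKappaMuModel g ε ξ η φ h R κ μ)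
    {a : ℝ} {X Y : V} (hX : HorizontalEigen η h a X)
    (hY : HorizontalEigen η h a Y) : HorizontalEigen η h a (X + Y) :=
  ⟨by rw [H.eta_add, hX.1, hY.1, add_zero], by rw [map_add, hX.2, hY.2, smul_add]⟩

theorem horizontalEigen_smul (H : IsKappaMuModel g ε ξ η φ h R κ μ)
    {a : ℝ} {X : V} (t : ℝ) (hX : HorizontalEigen η h a X) :
    HorizontalEigen η h a (t • X) :=
  ⟨by rw [H.eta_smul, hX.1, mul_zero], by rw [map_smul, hX.2, smul_comm]⟩

theorem phi_phi_of_horizontal (H : IsKappaMuModel g ε ξ η φ h R κ μ)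
    {X : V} (hX : η X = 0) : φ (φ X) = -X := by
  rw [H.phi_phi, hX, zero_smul, add_zero]

theorem orthogonal_of_ne (H : IsKappaMuModel g ε ξ η φ h R κ μ)
    {a b : ℝ} (hab : a ≠ b) {X Y : V} (hX : HorizontalEigen η h a X)
    (hY : HorizontalEigen η h b Y) : g X Y = 0 := by
  have h1 := H.h_symm X Y
  rw [hX.2, hY.2, map_smul, map_smul, LinearMap.smul_apply, smul_eq_mul, smul_eq_mul] at h1
  exact (mul_eq_zero.1 (by linear_combination h1 : (a - b) * g X Y = 0)).resolve_left
    (sub_ne_zero.2 hab)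

theorem h_curvature_eigen (H : IsKappaMuModel g ε ξ η φ h R κ μ)
    {x y z w : ℝ} {X Y Z W : V} (hX : HorizontalEigen η h x X)
    (hY : HorizontalEigen η h y Y) (hZ : HorizontalEigen η h z Z)
    (hW : HorizontalEigen η h w W) :
    (z - w) * g (R X Y Z) W
      = κ * (x - y) * (g Y (φ Z) * g (φ X) W + g X (φ Z) * g (φ Y) W)
        - 2 * ε * μ * z * g X (φ Y) * g (φ Z) W := by
  have h1 := congrArg (fun U => g U W) (H.h_curvature X Y Z)
  simp only [hX.1, hY.1, hZ.1, hX.2, hY.2, hZ.2, map_add, map_sub, map_smul,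
    LinearMap.add_apply, LinearMap.sub_apply, LinearMap.smul_apply, smul_eq_mul, H.h_symm,
    hW.2] at h1
  rw [H.symm Z (φ Y), H.phi_skew Y Z, H.symm Z (φ X), H.phi_skew X Z] at h1
  linear_combination h1

theorem phi_curvature_eigen (H : IsKappaMuModel g ε ξ η φ h R κ μ)
    {x y : ℝ} {X Y Z W : V} (hX : HorizontalEigen η h x X)
    (hY : HorizontalEigen η h y Y) (hZ : η Z = 0) (hW : η W = 0) :
    g (R X Y (φ Z)) W + g (R X Y Z) (φ W)
      = (1 + ε * x) * (1 + ε * y) * ε * (g X Z * g (φ Y) W - g Y Z * g (φ X) W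
        + g (φ X) Z * g Y W - g (φ Y) Z * g X W) := by
  have h1 := congrArg (fun U => g U W) (H.phi_curvature X Y Z)
  have h2 := H.sign_mul_self
  simp only [hX.1, hY.1, hZ, hX.2, hY.2, map_add, map_sub, map_smul,
    LinearMap.add_apply, LinearMap.sub_apply, LinearMap.smul_apply,
    smul_eq_mul, H.phi_skew (R X Y Z) W, (H.eta_eq_zero_iff W).1 hW] at h1
  linear_combination h1 + (- (1 + ε * y) * x * g Y Z * g (φ X) W
    + (1 + ε * x) * y * g X Z * g (φ Y) W - (1 + ε * x) * y * g (φ Y) Z * g X W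
    + (1 + ε * y) * x * g (φ X) Z * g Y W) * (-h2)

/-- The `φ`-holomorphic curvature of `A + B`, where `A` and `B` lie in opposite eigenspaces of `h`. -/
theorem phi_sectional_add (H : IsKappaMuModel g ε ξ η φ h R κ μ)
    {a : ℝ} (ha : a ≠ 0) {A B : V} (hA : HorizontalEigen η h a A)
    (hB : HorizontalEigen η h (-a) B) (ha2 : a * a = 1 - ε * κ) :
    g (R (A + B) (φ (A + B)) (φ (A + B))) (A + B)
      = -(κ + ε * μ) * g (A + B) (A + B) ^ 2
        + 4 * ε * (ε * κ + 1 - μ) * (g A A * g B B - g (φ A) B ^ 2) := by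
  have hφA := H.horizontalEigen_phi hA
  have hφB := H.horizontalEigen_phi hB
  rw [neg_neg] at hφB
  have hne : a ≠ -a := fun h => ha (by linarith)
  have e := H.sign_mul_self
  have gAB : g A B = 0 := H.orthogonal_of_ne hne hA hB
  have gBA : g B A = 0 := by rw [H.symm, gAB]
  have gAφA : g A (φ A) = 0 := H.orthogonal_of_ne hne hA hφA
  have gφAA : g (φ A) A = 0 := by rw [H.symm, gAφA]
  have gφBB : g (φ B) B = 0 := H.orthogonal_of_ne hne hφB hB
  have gφφ : g (φ A) (φ B) = 0 := H.orthogonal_of_ne hne.symm hφA hφB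
  have gφφ' : g (φ B) (φ A) = 0 := by rw [H.symm, gφφ]
  have gφAφA : g (φ A) (φ A) = g A A := by rw [H.phi_isometry, hA.1]; ring
  have gAφB : g A (φ B) = -g (φ A) B := by rw [H.phi_skew, neg_neg]
  have gφBA : g (φ B) A = -g (φ A) B := by rw [H.symm, gAφB]
  have φφA := H.phi_phi_of_horizontal hA.1
  have φφB := H.phi_phi_of_horizontal hB.1
  have mixed : ∀ {x y : ℝ} {X Y Z W : V}, HorizontalEigen η h x X → HorizontalEigen η h y Y →
      HorizontalEigen η h a Z → HorizontalEigen η h (-a) W →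
      g (R X Y Z) W = (κ * (x - y) * (g Y (φ Z) * g (φ X) W + g X (φ Z) * g (φ Y) W)
        - 2 * ε * μ * a * g X (φ Y) * g (φ Z) W) / (2 * a) := by
    intro x y X Y Z W hX hY hZ hW
    rw [eq_div_iff (by simpa using ha)]
    linear_combination H.h_curvature_eigen hX hY hZ hW
  have r1 : g (R A (φ A) (φ A)) A = -(κ + ε * μ) * g A A ^ 2 := by
    rw [H.skew_right, mixed hA hφA hA hφA]
    simp only [φφA, map_neg, LinearMap.neg_apply, gφAφA, gAφA]
    field_simp
    ring
  have r2 : g (R B (φ B) (φ B)) B = -(κ + ε * μ) * g B B ^ 2 := by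
    rw [mixed hB hφB hφB hB]
    simp only [φφB, map_neg, LinearMap.neg_apply, gφBB]
    field_simp
    ring
  have r3 : g (R A (φ A) (φ B)) B = -κ * g (φ A) B ^ 2 - ε * μ * g A A * g B B := by
    rw [mixed hA hφA hφB hB]
    simp only [φφA, φφB, map_neg, LinearMap.neg_apply, gAB]
    field_simp
    ring
  have r4 : g (R B (φ B) (φ A)) A = -κ * g (φ A) B ^ 2 - ε * μ * g A A * g B B := by
    rw [H.pair_symm, H.skew_left, H.skew_right, neg_neg, r3]
  have r5 : g (R A (φ B) (φ A)) B = (κ - ε * μ) * (g A A * g B B - g (φ A) B ^ 2) := by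
    have hb := congrArg (fun U => g U B) (H.bianchi A (φ B) (φ A))
    simp only [map_add, LinearMap.add_apply, map_zero, LinearMap.zero_apply] at hb
    rw [H.skew_left (φ A) A, r3, mixed hφB hφA hA hB] at hb
    simp only [φφA, φφB, map_neg, LinearMap.neg_apply, gφAφA, gφφ', gAB, gφBA] at hb
    field_simp at hb
    linear_combination hb / 2
  have r6 : g (R B (φ A) (φ B)) A = (κ - ε * μ) * (g A A * g B B - g (φ A) B ^ 2) := by
    rw [H.pair_symm, H.skew_left, H.skew_right, neg_neg, r5]
  have r7 := H.phi_curvature_eigen hA hφB hB.1 hA.1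
  have r8 := H.phi_curvature_eigen hB hφA hA.1 hB.1
  rw [H.skew_right A (φ B) B] at r7
  rw [H.skew_right B (φ A) A] at r8
  have z1 : g (R A (φ A) (φ A)) B = 0 := by
    rw [H.pair_symm, mixed hφA hB hA hφA]
    simp only [φφA, map_neg, LinearMap.neg_apply, gφφ, gφφ', gAφA]
    simp
  have z2 : g (R A (φ A) (φ B)) A = 0 := by
    rw [H.pair_symm, mixed hφB hA hA hφA]
    simp only [φφB, map_neg, LinearMap.neg_apply, gφφ', gAφA]
    simp
  have z3 : g (R B (φ B) (φ A)) B = 0 := by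
    rw [H.pair_symm, H.skew_right, mixed hφA hB hφB hB]
    simp only [φφA, φφB, map_neg, LinearMap.neg_apply, gφBB, gφφ, gAB]
    simp
  have z4 : g (R B (φ B) (φ B)) A = 0 := by
    rw [H.pair_symm, H.skew_right, mixed hφB hA hφB hB]
    simp only [φφB, map_neg, LinearMap.neg_apply, gφBB, gφφ', gAB]
    simp
  have z5 : g (R A (φ B) (φ A)) A = 0 := by rw [H.pair_symm, H.skew_left, H.skew_right, neg_neg, z2]
  have z6 : g (R B (φ A) (φ A)) A = 0 := by rw [H.pair_symm, H.skew_left, H.skew_right, neg_neg, z1]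
  have z7 : g (R A (φ B) (φ B)) B = 0 := by rw [H.pair_symm, H.skew_left, H.skew_right, neg_neg, z4]
  have z8 : g (R B (φ A) (φ B)) B = 0 := by rw [H.pair_symm, H.skew_left, H.skew_right, neg_neg, z3]
  simp only [φφA, φφB, map_neg, LinearMap.neg_apply, gφAA, gφBB, gAB, gBA, gφBA, r5, r6] at r7 r8
  simp only [map_add, LinearMap.add_apply, r1, r2, r3, r4, r5, r6, z1, z2, z3, z4, z5, z6, z7, z8,
    gAB, gBA]
  linear_combination r7 + r8 + 2 * ε ^ 3 * (g A A * g B B - g (φ A) B ^ 2) * ha2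
    + (2 * ε - 2 * κ * ε ^ 2 - 6 * κ) * (g A A * g B B - g (φ A) B ^ 2) * e

/-- On horizontal vectors `X ± a⁻¹ h X` projects, up to a factor `2`, onto an eigenspace of `h`. -/
theorem horizontalEigen_proj (H : IsKappaMuModel g ε ξ η φ h R κ μ)
    {a : ℝ} (ha : a ≠ 0) (ha2 : a * a = 1 - ε * κ) (X : V) :
    HorizontalEigen η h a (X - η X • ξ + a⁻¹ • h X) := by
  refine ⟨?_, ?_⟩
  · rw [H.eta_add, sub_eq_add_neg, H.eta_add, ← neg_smul, H.eta_smul, H.eta_smul, H.eta_xi,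
      H.eta_h]
    ring
  · have h1 : h (h X) = (a * a) • (X - η X • ξ) := by
      rw [H.h_h, H.phi_phi, ha2]; module
    rw [map_add, map_sub, map_smul, map_smul, h1, H.h_xi, smul_zero, sub_zero, smul_smul,
      inv_mul_cancel_left₀ ha, smul_add, smul_smul, mul_inv_cancel₀ ha, one_smul, add_comm]

theorem eq_zero_of_orthogonal_eigen (H : IsKappaMuModel g ε ξ η φ h R κ μ)
    {a : ℝ} (ha : a ≠ 0) (ha2 : a * a = 1 - ε * κ) {Z : V}
    (hZ : HorizontalEigen η h a Z) (hZC : ∀ C, HorizontalEigen η h a C → g Z C = 0) : Z = 0 := by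
  refine H.eq_zero_of_forall fun X => ?_
  have h1 := hZC _ (H.horizontalEigen_proj ha ha2 X)
  have h2 := H.orthogonal_of_ne (fun h => ha (by linarith)) hZ
    (H.horizontalEigen_proj (neg_ne_zero.2 ha) (by rw [neg_mul_neg, ha2]) X)
  have h3 : g Z ξ = 0 := by rw [H.symm, (H.eta_eq_zero_iff Z).1 hZ.1]
  simp only [map_add, map_sub, map_smul, smul_eq_mul, h3, inv_neg] at h1 h2
  linear_combination (h1 + h2) / 2

theorem finrank_le_three (H : IsKappaMuModel g ε ξ η φ h R κ μ)
    {a : ℝ} (ha : a ≠ 0) (ha2 : a * a = 1 - ε * κ) {A : V}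
    (hA : ∀ C, HorizontalEigen η h a C → C ∈ Submodule.span ℝ {A}) :
    Module.finrank ℝ V ≤ 3 := by
  classical
  have htop : Submodule.span ℝ (({ξ, A, φ A} : Finset V) : Set V) = ⊤ := by
    rw [eq_top_iff]
    intro X _
    have hP := H.horizontalEigen_proj ha ha2 X
    have hM := H.horizontalEigen_proj (neg_ne_zero.2 ha) (by rw [neg_mul_neg, ha2]) X
    obtain ⟨s, hs⟩ := Submodule.mem_span_singleton.1 (hA _ hP)
    have hφM := H.horizontalEigen_phi hM
    rw [neg_neg] at hφM
    obtain ⟨t, ht⟩ := Submodule.mem_span_singleton.1 (hA _ hφM)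
    have ht' := congrArg φ ht
    rw [H.phi_phi_of_horizontal hM.1, map_smul, inv_neg] at ht'
    have hX : X = η X • ξ + (s / 2) • A + (-t / 2) • φ A := by
      have h1 : (2 : ℝ) • X = (2 : ℝ) • (η X • ξ) + s • A + (-t) • φ A := by
        rw [hs, neg_smul, ht']; module
      have h2 := congrArg (fun U => (2⁻¹ : ℝ) • U) h1
      simp only [smul_smul, smul_add] at h2
      rw [inv_mul_cancel₀ two_ne_zero, one_smul] at h2
      exact h2.trans (by module)
    rw [hX]
    have hmem : ∀ U ∈ ({ξ, A, φ A} : Finset V),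
        U ∈ Submodule.span ℝ (({ξ, A, φ A} : Finset V) : Set V) :=
      fun U hU => Submodule.subset_span hU
    exact add_mem (add_mem (Submodule.smul_mem _ _ (hmem _ (by simp)))
      (Submodule.smul_mem _ _ (hmem _ (by simp)))) (Submodule.smul_mem _ _ (hmem _ (by simp)))
  have := finrank_span_finset_le_card (R := ℝ) ({ξ, A, φ A} : Finset V)
  rw [Set.finrank, htop, finrank_top] at this
  exact this.trans Finset.card_le_three

theorem exists_nonzero_gram (H : IsKappaMuModel g ε ξ η φ h R κ μ)
    {a : ℝ} (ha : a ≠ 0) (ha2 : a * a = 1 - ε * κ)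
    (hdim : 3 < Module.finrank ℝ V) :
    ∃ A C, HorizontalEigen η h a A ∧ HorizontalEigen η h a C ∧
      g A A * g C C - g A C ^ 2 ≠ 0 := by
  by_contra! hcon
  have polar : ∀ A C D, HorizontalEigen η h a A → HorizontalEigen η h a C →
      HorizontalEigen η h a D → g A A * g C D = g A C * g A D := by
    intro A C D hA hC hD
    have h1 := hcon A _ hA (H.horizontalEigen_add hC hD)
    have h2 := hcon A C hA hC
    have h3 := hcon A D hA hD
    simp only [map_add, LinearMap.add_apply, H.symm D C] at h1
    linear_combination (h1 - h2 - h3) / 2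
  by_cases hiso : ∀ A, HorizontalEigen η h a A → g A A = 0
  · refine hdim.not_ge (H.finrank_le_three ha ha2 (A := 0) fun Z hZ => ?_)
    rw [H.eq_zero_of_orthogonal_eigen ha ha2 hZ fun C hC => ?_]
    · exact zero_mem _
    · have h1 := hcon Z C hZ hC
      rw [hiso Z hZ] at h1
      simpa using h1
  · push Not at hiso
    obtain ⟨A, hA, hAA⟩ := hiso
    refine hdim.not_ge (H.finrank_le_three ha ha2 (A := A) fun C hC => ?_)
    have h1 : C + (-(g A C / g A A)) • A = 0 := by
      refine H.eq_zero_of_orthogonal_eigen ha ha2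
        (H.horizontalEigen_add hC (H.horizontalEigen_smul _ hA)) fun D hD => ?_
      simp only [map_add, map_smul, LinearMap.add_apply, LinearMap.smul_apply, smul_eq_mul]
      field_simp
      linear_combination polar A C D hA hC hD
    rw [eq_neg_of_add_eq_zero_left h1]
    exact neg_mem (Submodule.smul_mem _ _ (Submodule.mem_span_singleton_self A))

theorem exists_eigenvalue (H : IsKappaMuModel g ε ξ η φ h R κ μ)
    : ∃ a : ℝ, a ≠ 0 ∧ a * a = 1 - ε * κ := by
  have h1 : 0 < 1 - ε * κ := by linarith [H.kappa_lt]
  exact ⟨√(1 - ε * κ), (Real.sqrt_pos.2 h1).ne', Real.mul_self_sqrt h1.le⟩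

/-- A constant `φ`-sectional curvature determines both its value and `μ`. -/
theorem of_constant_phi_sectional (H : IsKappaMuModel g ε ξ η φ h R κ μ)
    (hdim : 3 < Module.finrank ℝ V) {c : ℝ}
    (hc : ∀ X : V, η X = 0 → g (R X (φ X) (φ X)) X = c * g X X ^ 2) :
    c = -(κ + ε * μ) ∧ μ = ε * κ + 1 := by
  obtain ⟨a, ha, ha2⟩ := H.exists_eigenvalue
  obtain ⟨A, C, hA, hC, hAC⟩ := H.exists_nonzero_gram ha ha2 hdim
  have hval : c = -(κ + ε * μ) := by
    by_contra hne
    have hiso : ∀ X, HorizontalEigen η h a X → g X X = 0 := by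
      intro X hX
      have h0 : HorizontalEigen η h (-a) (0 : V) := by
        simpa using H.horizontalEigen_smul 0 (H.horizontalEigen_phi hX)
      have h1 := H.phi_sectional_add ha hX h0 ha2
      simp only [add_zero] at h1
      rw [hc X hX.1] at h1
      simp only [map_zero, mul_zero] at h1
      have h2 : (c - -(κ + ε * μ)) * g X X ^ 2 = 0 := by linear_combination h1
      exact sq_eq_zero_iff.1 ((mul_eq_zero.1 h2).resolve_left (sub_ne_zero.2 hne))
    have h1 := hiso _ (H.horizontalEigen_add hA hC)
    simp only [map_add, LinearMap.add_apply, hiso A hA, hiso C hC, H.symm C A] at h1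
    refine hAC ?_
    rw [hiso A hA, (by linarith : g A C = 0)]
    ring
  refine ⟨hval, ?_⟩
  have hφC := H.horizontalEigen_phi hC
  have h1 := H.phi_sectional_add ha hA hφC ha2
  rw [hc _ (by rw [H.eta_add, hA.1, hφC.1, add_zero]), hval, H.phi_isometry, H.phi_isometry,
    hA.1, hC.1] at h1
  have h2 : 4 * ε * (ε * κ + 1 - μ) * (g A A * g C C - g A C ^ 2) = 0 := by
    linear_combination -h1
  have h3 := (mul_eq_zero.1 h2).resolve_right hAC
  have h4 := (mul_eq_zero.1 h3).resolve_left (mul_ne_zero four_ne_zero H.sign_ne_zero)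
  linarith

theorem constant_phi_sectional (H : IsKappaMuModel g ε ξ η φ h R κ μ)
    (hμ : μ = ε * κ + 1) {X : V} (hX : η X = 0) :
    g (R X (φ X) (φ X)) X = -(κ + ε * μ) * g X X ^ 2 := by
  obtain ⟨a, ha, ha2⟩ := H.exists_eigenvalue
  have h1 := H.phi_sectional_add ha
    (H.horizontalEigen_smul 2⁻¹ (H.horizontalEigen_proj ha ha2 X))
    (H.horizontalEigen_smul 2⁻¹
      (H.horizontalEigen_proj (neg_ne_zero.2 ha) (by rw [neg_mul_neg, ha2]) X)) ha2
  have h2 : (2⁻¹ : ℝ) • (X - η X • ξ + a⁻¹ • h X)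
      + (2⁻¹ : ℝ) • (X - η X • ξ + (-a)⁻¹ • h X) = X := by
    rw [hX, inv_neg]; module
  rw [h2] at h1
  rw [h1, hμ]
  ring

end IsKappaMuModel


theorem stmt_13
    {V : Type*} [AddCommGroup V] [Module ℝ V] [FiniteDimensional ℝ V]
    (n : ℕ) (hn : 1 ≤ n)
    (hdim : Module.finrank ℝ V = 2 * n + 1)
    (g : LinearMap.BilinForm ℝ V)
    (hg_symm : ∀ X Y : V, g X Y = g Y X)
    (hg_nd : g.Nondegenerate)
    (ε : ℝ) (hε : ε = 1 ∨ ε = -1)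
    (ξ : V) (hξ : g ξ ξ = ε)
    (η : V → ℝ) (hη : ∀ X : V, η X = ε * g ξ X)
    (φ : V →ₗ[ℝ] V)
    (hφ_sq : ∀ X : V, φ (φ X) = -X + η X • ξ)
    (hφ_g : ∀ X Y : V, g (φ X) (φ Y) = g X Y - ε * η X * η Y)
    (h : V →ₗ[ℝ] V)
    (hh_sym : ∀ X Y : V, g (h X) Y = g X (h Y))
    (hh_ξ : h ξ = 0)
    (hhφ : ∀ X : V, h (φ X) = - φ (h X))
    (hn1 : 1 < n)
    (R : V →ₗ[ℝ] V →ₗ[ℝ] V →ₗ[ℝ] V)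
    (hR_skew1 : ∀ X Y Z W : V, g (R X Y Z) W = - g (R Y X Z) W)
    (hR_skew2 : ∀ X Y Z W : V, g (R X Y Z) W = - g (R X Y W) Z)
    (hR_pair : ∀ X Y Z W : V, g (R X Y Z) W = g (R Z W X) Y)
    (hR_bianchi : ∀ X Y Z : V, R X Y Z + R Y Z X + R Z X Y = 0)
    (κ μ : ℝ)
    (hnull : ∀ X Y : V, R X Y ξ
      = (ε * κ) • (η Y • X - η X • Y) + (ε * μ) • (η Y • h X - η X • h Y))
    (hφR : ∀ X Y Z : V, R X Y (φ Z) = φ (R X Y Z)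
      + ((1 - ε * κ) * (η X * g (φ Y) Z - η Y * g (φ X) Z)
         + ε * (1 - μ) * (η X * g (φ (h Y)) Z - η Y * g (φ (h X)) Z)) • ξ
      - g (Y + ε • h Y) Z • (ε • φ X + φ (h X))
      + g (X + ε • h X) Z • (ε • φ Y + φ (h Y))
      - g (ε • φ Y + φ (h Y)) Z • (X + ε • h X)
      + g (ε • φ X + φ (h X)) Z • (Y + ε • h Y)
      - η Z • ((1 - ε * κ) • (η X • φ Y - η Y • φ X)
         + (ε * (1 - μ)) • (η X • φ (h Y) - η Y • φ (h X))))
    (hhR : ∀ X Y Z : V, R X Y (h Z) - h (R X Y Z)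
      = (κ * (η X * g (h Y) Z - η Y * g (h X) Z)
         + μ * (ε * κ - 1) * (η Y * g X Z - η X * g Y Z)) • ξ
      + κ • (g Y (φ Z) • φ (h X) - g X (φ Z) • φ (h Y) + g Z (φ (h Y)) • φ X
         - g Z (φ (h X)) • φ Y + (ε * η Z) • (η X • h Y - η Y • h X))
      - μ • (η Y • (((ε - κ) * η Z) • X + (μ * η X) • h Z)
         - η X • (((ε - κ) * η Z) • Y + (μ * η Y) • h Z)
         + (2 * ε * g X (φ Y)) • φ (h Z)))
    (hκ : ε * κ < 1)
    (hh2 : ∀ X : V, h (h X) = (ε * κ - 1) • φ (φ X)) :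
    ((∃ c : ℝ, ∀ X : V, η X = 0 → g (R X (φ X) (φ X)) X = c * g X X ^ 2) ↔ μ = ε * κ + 1) ∧
    (∀ c : ℝ, (∀ X : V, η X = 0 → g (R X (φ X) (φ X)) X = c * g X X ^ 2) →
      c = -(κ + ε * μ) ∧ c = -2 * κ - ε) := by
  have H : IsKappaMuModel g ε ξ η φ h R κ μ :=
    ⟨hg_symm, hg_nd, hε, hξ, hη, hφ_sq, hφ_g, hh_sym, hh_ξ, hhφ, hR_skew1, hR_skew2, hR_pair,
      hR_bianchi, hφR, hhR, hκ, hh2⟩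
  have hdim3 : 3 < Module.finrank ℝ V := by omega
  refine ⟨⟨fun ⟨c, hc⟩ => (H.of_constant_phi_sectional hdim3 hc).2,
    fun hμ => ⟨_, fun X hX => H.constant_phi_sectional hμ hX⟩⟩, fun c hc => ?_⟩
  obtain ⟨hval, hμ⟩ := H.of_constant_phi_sectional hdim3 hc
  refine ⟨hval, ?_⟩
  rw [hval, hμ]
  linear_combination -κ * H.sign_mul_self
end

section
/- Suppose the data (V,g,ε,ξ,η,φ,h,R) satisfies the (κ,μ)-nullity condition, Identity (φR), Identity (hR), εκ < 1 and h² = (εκ−1)φ², with λ = √(1−εκ) and D(±λ) the (±λ)-eigenspaces of h. Then for every X ∈ V with η(X) = 0, writing X = X_λ + X_{−λ} with X_λ ∈ D(λ) and X_{−λ} ∈ D(−λ), one has g(R(X,φX)φX,X) = −(κ+εμ)·g(X,X)² + 4(κ − εμ + ε)·[g(X_λ,X_λ)·g(X_{−λ},X_{−λ}) − g(X_λ,φX_{−λ})²]. In particular, for X with g(X,X) = 1 the φ-sectional curvature is K(X,φX) = −(κ+εμ) + 4(κ−εμ+ε)(g(X_λ,X_λ)g(X_{−λ},X_{−λ}) −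 g(X_λ,φX_{−λ})²). (Key formula in the proof of Theorem 3.10.) -/
theorem stmt_14
    {V : Type*} [AddCommGroup V] [Module ℝ V] [FiniteDimensional ℝ V]
    (n : ℕ) (hn : 1 ≤ n)
    (hdim : Module.finrank ℝ V = 2 * n + 1)
    (g : LinearMap.BilinForm ℝ V)
    (hg_symm : ∀ X Y : V, g X Y = g Y X)
    (hg_nd : g.Nondegenerate)
    (ε : ℝ) (hε : ε = 1 ∨ ε = -1)
    (ξ : V) (hξ : g ξ ξ = ε)
    (η : V → ℝ) (hη : ∀ X : V, η X = ε * g ξ X)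
    (φ : V →ₗ[ℝ] V)
    (hφ_sq : ∀ X : V, φ (φ X) = -X + η X • ξ)
    (hφ_g : ∀ X Y : V, g (φ X) (φ Y) = g X Y - ε * η X * η Y)
    (h : V →ₗ[ℝ] V)
    (hh_sym : ∀ X Y : V, g (h X) Y = g X (h Y))
    (hh_ξ : h ξ = 0)
    (hhφ : ∀ X : V, h (φ X) = - φ (h X))
    (R : V →ₗ[ℝ] V →ₗ[ℝ] V →ₗ[ℝ] V)
    (hR_skew1 : ∀ X Y Z W : V, g (R X Y Z) W = - g (R Y X Z) W)
    (hR_skew2 : ∀ X Y Z W : V, g (R X Y Z) W = - g (R X Y W) Z)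
    (hR_pair : ∀ X Y Z W : V, g (R X Y Z) W = g (R Z W X) Y)
    (hR_bianchi : ∀ X Y Z : V, R X Y Z + R Y Z X + R Z X Y = 0)
    (κ μ : ℝ)
    (hnull : ∀ X Y : V, R X Y ξ
      = (ε * κ) • (η Y • X - η X • Y) + (ε * μ) • (η Y • h X - η X • h Y))
    (hφR : ∀ X Y Z : V, R X Y (φ Z) = φ (R X Y Z)
      + ((1 - ε * κ) * (η X * g (φ Y) Z - η Y * g (φ X) Z)
         + ε * (1 - μ) * (η X * g (φ (h Y)) Z - η Y * g (φ (h X)) Z)) • ξ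
      - g (Y + ε • h Y) Z • (ε • φ X + φ (h X))
      + g (X + ε • h X) Z • (ε • φ Y + φ (h Y))
      - g (ε • φ Y + φ (h Y)) Z • (X + ε • h X)
      + g (ε • φ X + φ (h X)) Z • (Y + ε • h Y)
      - η Z • ((1 - ε * κ) • (η X • φ Y - η Y • φ X)
         + (ε * (1 - μ)) • (η X • φ (h Y) - η Y • φ (h X))))
    (hhR : ∀ X Y Z : V, R X Y (h Z) - h (R X Y Z)
      = (κ * (η X * g (h Y) Z - η Y * g (h X) Z)
         + μ * (ε * κ - 1) * (η Y * g X Z - η X * g Y Z)) • ξ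
      + κ • (g Y (φ Z) • φ (h X) - g X (φ Z) • φ (h Y) + g Z (φ (h Y)) • φ X
         - g Z (φ (h X)) • φ Y + (ε * η Z) • (η X • h Y - η Y • h X))
      - μ • (η Y • (((ε - κ) * η Z) • X + (μ * η X) • h Z)
         - η X • (((ε - κ) * η Z) • Y + (μ * η Y) • h Z)
         + (2 * ε * g X (φ Y)) • φ (h Z)))
    (hκ : ε * κ < 1)
    (hh2 : ∀ X : V, h (h X) = (ε * κ - 1) • φ (φ X))
    (lam : ℝ) (hlam : lam = Real.sqrt (1 - ε * κ)) :
    ∀ X Xp Xn : V, η X = 0 → h Xp = lam • Xp → h Xn = (-lam) • Xn → X = Xp + Xn →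
      (g (R X (φ X) (φ X)) X
        = -(κ + ε * μ) * g X X ^ 2
          + 4 * (κ - ε * μ + ε) * (g Xp Xp * g Xn Xn - g Xp (φ Xn) ^ 2)) ∧
      (g X X = 1 → g (R X (φ X) (φ X)) X / g X X ^ 2
        = -(κ + ε * μ) + 4 * (κ - ε * μ + ε) * (g Xp Xp * g Xn Xn - g Xp (φ Xn) ^ 2)) := by
  intro X P N hX hP hN hXPN
  have hε2 : ε ^ 2 = 1 := by rcases hε with rfl | rfl <;> norm_num
  have hε0 : ε ≠ 0 := by rintro rfl; norm_num at hε2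
  have hlam_pos : 0 < lam := hlam ▸ Real.sqrt_pos.mpr (by linarith)
  have hlam_ne : lam ≠ 0 := hlam_pos.ne'
  have hlam_sq : lam ^ 2 = 1 - ε * κ := by rw [hlam, Real.sq_sqrt (by linarith)]
  have hη_of_eigen : ∀ (s : ℝ) (Y : V), s ≠ 0 → h Y = s • Y → η Y = 0 := by
    intro s Y hs hY
    have e := hh_sym ξ Y
    rw [hh_ξ, hY] at e
    simp only [map_zero, LinearMap.zero_apply, map_smul, smul_eq_mul] at e
    rw [hη, (mul_eq_zero.mp e.symm).resolve_left hs, mul_zero]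
  have hφ_eigen : ∀ (s : ℝ) (Y : V), h Y = s • Y → h (φ Y) = (-s) • φ Y := by
    intro s Y hY
    rw [hhφ, hY, map_smul, neg_smul]
  have horth : ∀ (s : ℝ) (Y Z : V), s ≠ 0 → h Y = s • Y → h Z = (-s) • Z → g Y Z = 0 := by
    intro s Y Z hs hY hZ
    have e := hh_sym Y Z
    rw [hY, hZ] at e
    simp only [map_smul, LinearMap.smul_apply, smul_eq_mul] at e
    have : s * g Y Z = 0 := by linarith
    exact (mul_eq_zero.mp this).resolve_left hs
  have hgξ : ∀ Y : V, η Y = 0 → g ξ Y = 0 := by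
    intro Y hY
    rw [hη] at hY
    exact (mul_eq_zero.mp hY).resolve_left hε0
  have hφ_skew : ∀ Y Z : V, η Y = 0 → η Z = 0 → η (φ Z) = 0 → g (φ Y) Z = - g Y (φ Z) := by
    intro Y Z hY hZ hφZ
    have e := hφ_g Y (φ Z)
    rw [hφ_sq, hY, hZ] at e
    simp only [zero_smul, add_zero, map_neg] at e
    linarith
  -- On horizontal vectors, `hR` determines the curvature that mixes the two eigenspaces.
  have hmixed : ∀ (s x y : ℝ) (A B C D : V), s ≠ 0 → η A = 0 → η B = 0 → η C = 0 → η D = 0 →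
      h A = (x * s) • A → h B = (y * s) • B → h C = s • C → h D = (-s) • D →
      2 * g (R A B C) D
        = κ * (x * g B (φ C) * g (φ A) D - y * g A (φ C) * g (φ B) D
            + y * g C (φ B) * g (φ A) D - x * g C (φ A) * g (φ B) D)
          - 2 * μ * ε * g A (φ B) * g (φ C) D := by
    intro s x y A B C D hs hA hB hC hD hhA hhB hhC hhD
    have e := congrArg (fun v => g v D) (hhR A B C)
    have e2 := hh_sym (R A B C) D
    simp only [hA, hB, hC, hhA, hhB, hhC, hhD, map_smul, map_add, map_sub, LinearMap.add_apply,
      LinearMap.sub_apply, LinearMap.smul_apply, smul_eq_mul, hgξ D hD] at e e2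
    apply mul_left_cancel₀ hs
    linear_combination e + e2
  have hφ_curv : ∀ A B C D : V, ∀ x y : ℝ, η A = 0 → η B = 0 → η C = 0 → η D = 0 →
      η (φ D) = 0 → η (R A B C) = 0 → h A = x • A → h B = y • B →
      g (R A B (φ C)) D = - g (R A B C) (φ D)
        - (1 + ε * y) * (ε + x) * g B C * g (φ A) D
        + (1 + ε * x) * (ε + y) * g A C * g (φ B) D
        - (ε + y) * (1 + ε * x) * g (φ B) C * g A D
        + (ε + x) * (1 + ε * y) * g (φ A) C * g B D := by
    intro A B C D x y hA hB hC hD hφD hRC hhA hhB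
    have e := congrArg (fun v => g v D) (hφR A B C)
    have e2 := hφ_skew (R A B C) D hRC hD hφD
    simp only [hA, hB, hC, hhA, hhB, map_smul, map_add, map_sub, LinearMap.add_apply,
      LinearMap.sub_apply, LinearMap.smul_apply, smul_eq_mul, hgξ D hD] at e
    linear_combination e + e2
  have hη_curv : ∀ A B C : V, η A = 0 → η B = 0 → η (R A B C) = 0 := by
    intro A B C hA hB
    have e := hR_skew2 A B C ξ
    rw [hnull, hA, hB] at e
    simp only [zero_smul, sub_zero, smul_zero, add_zero, map_zero, LinearMap.zero_apply,
      neg_zero] at e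
    rw [hη, hg_symm, e, mul_zero]
  have hnlam : -lam ≠ 0 := neg_ne_zero.mpr hlam_ne
  have hM := hφ_eigen _ _ hP
  have hQ := hφ_eigen _ _ hN
  rw [neg_neg] at hQ
  have ηP := hη_of_eigen _ _ hlam_ne hP
  have ηN := hη_of_eigen _ _ hnlam hN
  have ηM := hη_of_eigen _ _ hnlam hM
  have ηQ := hη_of_eigen _ _ hlam_ne hQ
  have φM := hφ_sq P
  have φQ := hφ_sq N
  rw [ηP, zero_smul, add_zero] at φM
  rw [ηN, zero_smul, add_zero] at φQ
  have gPN := horth _ _ _ hlam_ne hP hN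
  have gPM := horth _ _ _ hlam_ne hP hM
  have gQN := horth _ _ _ hlam_ne hQ hN
  have gQM := horth _ _ _ hlam_ne hQ hM
  have gMN := hφ_skew P N ηP ηN ηQ
  have gMM := hφ_g P P
  have gQQ := hφ_g N N
  simp only [ηP, ηN, mul_zero, sub_zero] at gMM gQQ
  have gNP := (hg_symm N P).trans gPN
  have gMP := (hg_symm (φ P) P).trans gPM
  have gNM := (hg_symm N (φ P)).trans gMN
  have gQP := hg_symm (φ N) P
  have eP : h P = (1 * lam) • P := by rw [hP, one_mul]
  have eQ : h (φ N) = (1 * lam) • φ N := by rw [hQ, one_mul]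
  have eM : h (φ P) = (-1 * lam) • φ P := by rw [hM, neg_one_mul]
  have eN : h N = (-1 * lam) • N := by rw [hN, neg_one_mul]
  have mixedPN : ∀ (x y : ℝ) (A B : V), η A = 0 → η B = 0 → h A = (x * lam) • A →
      h B = (y * lam) • B → _ := fun x y A B hA hB hhA hhB =>
    hmixed lam x y A B P N hlam_ne hA hB ηP ηN hhA hhB hP hN
  have mixedPM : ∀ (x y : ℝ) (A B : V), η A = 0 → η B = 0 → h A = (x * lam) • A →
      h B = (y * lam) • B → _ := fun x y A B hA hB hhA hhB =>
    hmixed lam x y A B P (φ P) hlam_ne hA hB ηP ηM hhA hhB hP hM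
  have mixedQN : ∀ (x y : ℝ) (A B : V), η A = 0 → η B = 0 → h A = (x * lam) • A →
      h B = (y * lam) • B → _ := fun x y A B hA hB hhA hhB =>
    hmixed lam x y A B (φ N) N hlam_ne hA hB ηQ ηN hhA hhB hQ hN
  have t1 := mixedPM _ _ _ _ ηP ηM eP eM
  have t2 := mixedPM _ _ _ _ ηP ηQ eP eQ
  have t3 := mixedPM _ _ _ _ ηN ηM eN eM
  have t4 := mixedPM _ _ _ _ ηN ηQ eN eQ
  have t5 := mixedQN _ _ _ _ ηP ηM eP eM
  have t6 := mixedQN _ _ _ _ ηP ηQ eP eQ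
  have t7 := mixedQN _ _ _ _ ηN ηM eN eM
  have t8 := mixedQN _ _ _ _ ηN ηQ eN eQ
  have b1 := mixedPN _ _ _ _ ηQ ηM eQ eM
  have b2 := mixedQN _ _ _ _ ηM ηP eM eP
  have bi := congrArg (fun v => g v N) (hR_bianchi P (φ N) (φ P))
  have f1 := hφ_curv P (φ N) N P _ _ ηP ηQ ηN ηP ηM (hη_curv _ _ _ ηP ηQ) hP hQ
  have f2 := hφ_curv N (φ P) P N _ _ ηN ηM ηP ηN ηQ (hη_curv _ _ _ ηN ηM) hN hM
  simp only [map_add, LinearMap.add_apply, map_zero, LinearMap.zero_apply] at bi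
  simp only [φM, φQ, map_neg, LinearMap.neg_apply, gPN, gPM, gQN, gQM, gMN, gMM, gQQ, gNP, gMP,
    gNM, gQP] at t1 t2 t3 t4 t5 t6 t7 t8 b1 b2 f1 f2
  have hκ_eq : κ = ε * (1 - lam ^ 2) := by rw [hlam_sq]; linear_combination (-κ) * hε2
  have key : g (R X (φ X) (φ X)) X
      = -(κ + ε * μ) * g X X ^ 2
        + 4 * (κ - ε * μ + ε) * (g P P * g N N - g P (φ N) ^ 2) := by
    subst hXPN
    have s1 := hR_skew2 P (φ P) (φ P) P
    have s2 := hR_skew2 P (φ N) (φ P) P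
    have s3 := hR_skew2 N (φ P) (φ P) P
    have s4 := hR_skew2 N (φ N) (φ P) P
    have p1 := (hR_pair P (φ P) (φ P) N).trans (hR_skew1 _ _ _ _)
    have p2 := (hR_pair P (φ P) (φ N) P).trans (hR_skew1 _ _ _ _)
    have p3 := ((hR_pair N (φ N) (φ P) N).trans (hR_skew1 _ _ _ _)).trans
      (congrArg Neg.neg (hR_skew2 _ _ _ _))
    have p4 := ((hR_pair N (φ N) (φ N) P).trans (hR_skew1 _ _ _ _)).trans
      (congrArg Neg.neg (hR_skew2 _ _ _ _))
    have p5 := ((hR_pair N (φ P) (φ N) P).trans (hR_skew1 _ _ _ _)).trans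
      (congrArg Neg.neg (hR_skew2 _ _ _ _))
    have p6 := (hR_pair N (φ P) P (φ N)).trans (hR_skew2 _ _ _ _)
    have s5 := hR_skew2 P (φ N) N (φ P)
    simp only [map_add, LinearMap.add_apply, gPN, gNP]
    rcases hε with rfl | rfl
    all_goals
      simp only [one_mul, neg_one_mul] at hκ_eq
      rw [hκ_eq] at t1 t2 t3 t4 t5 t6 t7 t8 b1 b2 ⊢
      linarith
  refine ⟨key, fun hX1 => ?_⟩
  rw [key, hX1]
  ring
end
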